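/- arXiv:2112.12096 — 2 statements merged into one kernel-verified Lean document; each statement's English description precedes it below -/
import Mathlib

section
/- Fix x_0 ∈ V and n ≥ 2(N_4(x_0) ∨ N_5(x_0)), and write B(σ) := B^ω(x_0, σn) for σ ∈ [1/2,1]. Let u ≥ 0 satisfy L u ≥ 0 on B(1), let φ: V → (0,∞), and set v := φ·u. Then, under the graph assumption, for any p, q ∈ (1,∞] with 1/p + 1/q < 2/d', there exist γ' = γ'(d',p,q) ∈ (1,∞) and c_{36} = c_{36}(d',p,q) such that for all β ∈ [2p_*, ∞] and all 1/2 ≤ σ' < σ ≤ 1: ‖v‖_{β,B(σ')} ≤ c_{36} ( m^ω(n)/(σ−σ')² )^{γ'} ‖v‖_{2p_*,B(σ)}, where p_* := p/(p−1) and m^ω(n) := ‖1∨μ‖_{p,B^ω(x_0,n)} · ‖1∨ν‖_{q,B^ω(x_0,n)} · (1 + ‖Γ(φ,φ^{−1})‖_{p,B^ω(x_0,n)} n²). -/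
open MeasureTheory Filter ENNReal Topology
open scoped Classical

namespace FPPPaper

/-! ## Basic geometry of `ℤ^d` -/

/-- Vertices of the lattice `ℤ^d`. -/
abbrev Vert (d : ℕ) := Fin d → ℤ

/-- Nearest-neighbour adjacency on `ℤ^d`. -/
def adj {d : ℕ} (x y : Vert d) : Prop := (∑ i, (x i - y i).natAbs) = 1

/-- The `ℓ^∞`-distance on `ℤ^d`. -/
def linfDist {d : ℕ} (x y : Vert d) : ℕ := Finset.univ.sup fun i => (x i - y i).natAbs

/-- The `ℓ^1`-distance on `ℤ^d`. -/
def l1Dist {d : ℕ} (x y : Vert d) : ℕ := ∑ i, (x i - y i).natAbs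

/-- The canonical embedding `ℤ^d → ℝ^d`. -/
def toRvec {d : ℕ} (x : Vert d) : Fin d → ℝ := fun i => (x i : ℝ)

/-- `p` is a nearest-neighbour path from `x` to `y` (a list of consecutively
adjacent vertices starting at `x` and ending at `y`). -/
def IsPathFrom {d : ℕ} (x y : Vert d) (p : List (Vert d)) : Prop :=
  p.head? = some x ∧ p.getLast? = some y ∧ p.Chain' adj

/-- The (ordered) edges traversed by a path. -/
def edgesOf {d : ℕ} (p : List (Vert d)) : List (Vert d × Vert d) := p.zip p.tail

/-- Total weight of a path for edge weights `w`. -/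
noncomputable def pathWeight {d : ℕ} (w : Vert d → Vert d → ℝ≥0∞) (p : List (Vert d)) :
    ℝ≥0∞ :=
  ((edgesOf p).map fun e => w e.1 e.2).sum

/-- The first passage percolation (pseudo-)distance associated to edge weights `w`. -/
noncomputable def fppDist {d : ℕ} (w : Vert d → Vert d → ℝ≥0∞) (x y : Vert d) : ℝ≥0∞ :=
  ⨅ p : {p : List (Vert d) // IsPathFrom x y p}, pathWeight w p.1

/-- Total weight of a path for vertex weights `w`. -/
noncomputable def vertPathWeight {d : ℕ} (w : Vert d → ℝ≥0∞) (p : List (Vert d)) : ℝ≥0∞ :=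
  (p.map w).sum

/-- The first passage percolation distance associated to vertex weights `w`. -/
noncomputable def vfppDist {d : ℕ} (w : Vert d → ℝ≥0∞) (x y : Vert d) : ℝ≥0∞ :=
  ⨅ p : {p : List (Vert d) // IsPathFrom x y p}, vertPathWeight w p.1

/-- `x` and `y` are connected by a path all of whose edges belong to `S`. -/
def ConnectedIn {d : ℕ} (S : Set (Vert d × Vert d)) (x y : Vert d) : Prop :=
  ∃ p, IsPathFrom x y p ∧ ∀ e ∈ edgesOf p, e ∈ S

/-- `x` and `y` are connected by a path all of whose vertices belong to `S`. -/
def VConnectedIn {d : ℕ} (S : Set (Vert d)) (x y : Vert d) : Prop :=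
  ∃ p, IsPathFrom x y p ∧ ∀ v ∈ p, v ∈ S

/-- The cube `Q(x,r) = {y : |x-y|_∞ ≤ r}`. -/
def cubeVerts {d : ℕ} (x : Vert d) (r : ℝ) : Set (Vert d) :=
  {y | ∀ i, |(y i : ℝ) - (x i : ℝ)| ≤ r}

/-- The set of edges with weight zero. -/
def zeroSet {d : ℕ} (w : Vert d → Vert d → ℝ≥0∞) : Set (Vert d × Vert d) :=
  {e | adj e.1 e.2 ∧ w e.1 e.2 = 0}

/-! ## Configuration spaces indexed by vertices and edges -/

/-- Index set for configurations: vertices and (ordered) edges of `ℤ^d`. -/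
abbrev Coord (d : ℕ) := Vert d ⊕ (Vert d × Vert d)

/-- The vertices underlying a coordinate. -/
def coordVerts {d : ℕ} : Coord d → Set (Vert d)
  | Sum.inl v => {v}
  | Sum.inr e => {e.1, e.2}

/-- The configuration space `Ω = ∏_{e} Ω_e × ∏_x Ω_x` with all coordinate spaces
equal to `Γ`. -/
abbrev Config (d : ℕ) (Γ : Type*) := Coord d → Γ

/-- The lattice shift `τ_z` on configurations. -/
def shiftConfig {d : ℕ} {Γ : Type*} (z : Vert d) (ω : Config d Γ) : Config d Γ :=
  fun c => ω (match c with
    | Sum.inl v => Sum.inl (v + z)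
    | Sum.inr e => Sum.inr (e.1 + z, e.2 + z))

/-- A function of the configuration is supported on the set `S` of coordinates. -/
def SupportedOn {d : ℕ} {Γ β : Type*} (S : Set (Coord d)) (f : Config d Γ → β) : Prop :=
  ∀ ω ω' : Config d Γ, (∀ c ∈ S, ω c = ω' c) → f ω = f ω'

/-- An event on pairs of configurations depending only on the coordinates of the first
configuration in `S1` and of the second one in `S2`. -/
def PairSupportedOn {d : ℕ} {Γ : Type*} (S1 S2 : Set (Coord d))
    (A : Set (Config d Γ × Config d Γ)) : Prop :=
  ∀ ω1 ω2 ω1' ω2' : Config d Γ, (∀ c ∈ S1, ω1 c = ω1' c) → (∀ c ∈ S2, ω2 c = ω2' c) →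
    ((ω1, ω2) ∈ A ↔ (ω1', ω2') ∈ A)

/-- The coordinates of the box `Q̄(x,r)`: vertices of the cube `Q(x,r)` together with
the edges having both endpoints in the cube. -/
def boxCoords {d : ℕ} (x : Vert d) (r : ℝ) : Set (Coord d) :=
  {c | ∀ v ∈ coordVerts c, v ∈ cubeVerts x r}

/-- The coordinates within `ℓ^∞`-distance `r` of `x` or `y` (the neighbourhoods
`𝒩 + x` and `𝒩 + y` together with the edge `{x,y}`). -/
def nbhdCoords {d : ℕ} (r : ℕ) (x y : Vert d) : Set (Coord d) :=
  {c | ∀ v ∈ coordVerts c, linfDist v x ≤ r ∨ linfDist v y ≤ r}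

/-- Two sets of coordinates are at mutual distance at least `r`. -/
def coordSetsFar {d : ℕ} (S1 S2 : Set (Coord d)) (r : ℝ) : Prop :=
  ∀ c1 ∈ S1, ∀ c2 ∈ S2, ∀ v1 ∈ coordVerts c1, ∀ v2 ∈ coordVerts c2,
    r ≤ (linfDist v1 v2 : ℝ)

/-! ## The conditions P1, P2, P3, P3', S1, S2 and Z -/

/-- Condition **P1** (invariance and directional ergodicity): each `P u` is invariant
under lattice shifts and every event invariant under a nonzero shift is trivial. -/
def CondP1 {d : ℕ} {Γ : Type*} [MeasurableSpace Γ]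
    (P : ℝ → Measure (Config d Γ)) (I : Set ℝ) : Prop :=
  ∀ u ∈ I, (∀ z : Vert d, MeasurePreserving (shiftConfig z) (P u) (P u)) ∧
    (∀ z : Vert d, z ≠ 0 → ∀ A : Set (Config d Γ), MeasurableSet A →
      shiftConfig z ⁻¹' A = A → P u A = 0 ∨ P u A = 1)

/-- Condition **P2** (stochastic monotonicity in the parameter `u`). -/
def CondP2 {d : ℕ} {Γ : Type*} [MeasurableSpace Γ] [Preorder Γ]
    (P : ℝ → Measure (Config d Γ)) (I : Set ℝ) : Prop :=
  ∀ f : Config d Γ → ℝ, Measurable f → Monotone f → (∀ ω, f ω ∈ Set.Icc (0:ℝ) 1) →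
    ∀ u ∈ I, ∀ u' ∈ I, u ≤ u' → ∫ ω, f ω ∂(P u) ≤ ∫ ω, f ω ∂(P u')

/-- Condition **P3** (decoupling inequality with sprinkling): after possibly
extending the underlying probability space (the extension is given by `Ω'`, `π`
and the family `Q`), for distant boxes and sprinkled levels there is an event `B`
of high probability on which increasing (resp. decreasing) events on the two boxes
can be compared with their probabilities under independent copies. -/
def CondP3 {d : ℕ} {Γ : Type*} [MeasurableSpace Γ] [Preorder Γ]
    (P : ℝ → Measure (Config d Γ)) (I : Set ℝ)
    (ξP εP aP CP χP RP LP : ℝ) : Prop :=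
  1 < ξP ∧ 0 < εP ∧ 0 < aP ∧ 0 < CP ∧ 0 < χP ∧ 0 < RP ∧ 0 < LP ∧
  ∃ (Ω' : Type) (mΩ' : MeasurableSpace Ω') (π : Ω' → Config d Γ)
    (Q : ℝ → @Measure Ω' mΩ') (fP : ℝ → ℝ),
    (@Measurable Ω' (Config d Γ) mΩ' _ π) ∧
    (∀ u ∈ I, @Measure.map Ω' (Config d Γ) mΩ' _ π (Q u) = P u) ∧
    (∀ L : ℝ, LP ≤ L → Real.exp (aP * Real.log L ^ εP) ≤ fP L) ∧
    ∀ (R L : ℝ) (x1 x2 : Vert d) (u uh : ℝ), u ∈ I → uh ∈ I → RP ≤ R → LP ≤ L →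
      (∀ v1 ∈ cubeVerts x1 (L ^ ξP), ∀ v2 ∈ cubeVerts x2 (L ^ ξP),
        R * L ≤ (linfDist v1 v2 : ℝ)) →
      uh + R ^ (-χP) ≤ u →
      ∃ B : Set Ω', @MeasurableSet Ω' mΩ' B ∧
        Q u Bᶜ ≤ ENNReal.ofReal (Real.exp (-(CP * fP L))) ∧
        (∀ A : Set (Config d Γ × Config d Γ), MeasurableSet A → IsUpperSet A →
            PairSupportedOn (boxCoords x1 (L ^ ξP)) (boxCoords x2 (L ^ ξP)) A →
            Q uh {ω' | ω' ∈ B ∧ (π ω', π ω') ∈ A} ≤ ((P u).prod (P u)) A) ∧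
        (∀ A : Set (Config d Γ × Config d Γ), MeasurableSet A → IsLowerSet A →
            PairSupportedOn (boxCoords x1 (L ^ ξP)) (boxCoords x2 (L ^ ξP)) A →
            Q u {ω' | ω' ∈ B ∧ (π ω', π ω') ∈ A} ≤ ((P uh).prod (P uh)) A)

/-- Condition **P3'** (decoupling inequality for sparse sets with super-exponential
error term). -/
def CondP3' {d : ℕ} {Γ : Type*} [MeasurableSpace Γ] [Preorder Γ]
    (P : ℝ → Measure (Config d Γ)) (I : Set ℝ)
    (ξP CP χP RP LP : ℝ) : Prop :=
  1 < ξP ∧ 0 < CP ∧ 0 < χP ∧ 0 < RP ∧ 0 < LP ∧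
  ∀ (R L : ℝ) (x1 x2 : Vert d) (u uh : ℝ), u ∈ I → uh ∈ I → RP ≤ R → LP ≤ L →
    uh + R ^ (-χP) ≤ u →
    ∀ S1 S2 : Set (Coord d), S1 ⊆ boxCoords x1 (L ^ ξP) → S2 ⊆ boxCoords x2 (L ^ ξP) →
      (S1.ncard : ℝ) ≤ L ^ ξP → (S2.ncard : ℝ) ≤ L ^ ξP →
      coordSetsFar S1 S2 (R * L) →
      (∀ f1 f2 : Config d Γ → ℝ, Measurable f1 → Measurable f2 →
        Monotone f1 → Monotone f2 →
        (∀ ω, f1 ω ∈ Set.Icc (0:ℝ) 1) → (∀ ω, f2 ω ∈ Set.Icc (0:ℝ) 1) →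
        SupportedOn S1 f1 → SupportedOn S2 f2 →
        ∫ ω, f1 ω * f2 ω ∂(P uh) ≤ (∫ ω, f1 ω ∂(P u)) * (∫ ω, f2 ω ∂(P u))
          + Real.exp (-(CP * L ^ ξP))) ∧
      (∀ f1 f2 : Config d Γ → ℝ, Measurable f1 → Measurable f2 →
        Antitone f1 → Antitone f2 →
        (∀ ω, f1 ω ∈ Set.Icc (0:ℝ) 1) → (∀ ω, f2 ω ∈ Set.Icc (0:ℝ) 1) →
        SupportedOn S1 f1 → SupportedOn S2 f2 →
        ∫ ω, f1 ω * f2 ω ∂(P u) ≤ (∫ ω, f1 ω ∂(P uh)) * (∫ ω, f2 ω ∂(P uh))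
          + Real.exp (-(CP * L ^ ξP)))

/-- Condition **(Z)**: `liminf_{L→∞} sup_x P^u(Q(x,L) ↔ Q(x,2L)^c in {e : t_e = 0}) = 0`
for every `u ∈ I`. -/
def CondZ {d : ℕ} {Γ : Type*} [MeasurableSpace Γ]
    (P : ℝ → Measure (Config d Γ)) (I : Set ℝ)
    (w : Config d Γ → Vert d → Vert d → ℝ≥0∞) : Prop :=
  ∀ u ∈ I,
    Filter.liminf (fun L : ℕ =>
      ⨆ x : Vert d, P u {ω | ∃ v1 ∈ cubeVerts x (L : ℝ), ∃ v2,
        v2 ∉ cubeVerts x ((2 * L : ℕ) : ℝ) ∧ ConnectedIn (zeroSet (w ω)) v1 v2})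
      Filter.atTop = 0

/-- The function `g_P^{(δ)}` of the main theorem: equal to `L` if condition P3' holds
and otherwise given by the P3-formula. -/
noncomputable def gP3formula (δ εP aP χP L : ℝ) : ℝ :=
  min L (Real.log L ^ (-(δ * (1 + aP + aP / χP))) * Real.exp (aP * Real.log L ^ εP))

noncomputable def gdelta (p3' : Prop) (δ εP aP χP L : ℝ) : ℝ :=
  if p3' then L else gP3formula δ εP aP χP L

/-! ## The renormalization scheme -/

/-- `ρ_k = ρ` for `k < K` and `ρ_k = 1` for `k ≥ K`. -/
def rhok (ρ K k : ℕ) : ℕ := if k < K then ρ else 1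

/-- The sequence of scales `L_{k+1} = 2 L_k (1 + ρ_k/(k+6)^δ)`. -/
noncomputable def Lseq (δ : ℝ) (ρ K : ℕ) (L0 : ℝ) : ℕ → ℝ
  | 0 => L0
  | k + 1 => 2 * Lseq δ ρ K L0 k * (1 + (rhok ρ K k : ℝ) / ((k : ℝ) + 6) ^ δ)

/-- The box `C_x^k = x + [0, L_k)^d ∩ ℤ^d`. -/
def CkSet {d : ℕ} (δ : ℝ) (ρ K : ℕ) (L0 : ℝ) (k : ℕ) (x : Vert d) : Set (Vert d) :=
  {y | ∀ i, (0:ℝ) ≤ ((y i - x i : ℤ) : ℝ) ∧ ((y i - x i : ℤ) : ℝ) < Lseq δ ρ K L0 k}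

/-- The box `D_x^k = x + [-L_k, 2 L_k)^d ∩ ℤ^d`. -/
def DkSet {d : ℕ} (δ : ℝ) (ρ K : ℕ) (L0 : ℝ) (k : ℕ) (x : Vert d) : Set (Vert d) :=
  {y | ∀ i, -(Lseq δ ρ K L0 k) ≤ ((y i - x i : ℤ) : ℝ) ∧
    ((y i - x i : ℤ) : ℝ) < 2 * Lseq δ ρ K L0 k}

/-- `d_k^ω(x)`: the FPP distance between `C_x^k` and the complement of `D_x^k`. -/
noncomputable def dkDist {d : ℕ} (δ : ℝ) (ρ K : ℕ) (L0 : ℝ) (k : ℕ) (x : Vert d)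
    (w : Vert d → Vert d → ℝ≥0∞) : ℝ≥0∞ :=
  ⨅ p : {p : List (Vert d) // ∃ a b, a ∈ CkSet δ ρ K L0 k x ∧ b ∉ DkSet δ ρ K L0 k x ∧
      IsPathFrom a b p}, pathWeight w p.1

/-- `ε_k = Σ_{p ≥ k} ε/(p+6)^δ`. -/
noncomputable def epsk (δ ε : ℝ) (k : ℕ) : ℝ :=
  ∑' j : ℕ, ε / (((k + j : ℕ) : ℝ) + 6) ^ δ

/-- `a_k = 2^k ∏_{i=0}^{k-1} (1 - 1/(i+6)^δ)`. -/
noncomputable def aseq (δ : ℝ) (k : ℕ) : ℝ :=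
  2 ^ k * ∏ i ∈ Finset.range k, (1 - 1 / (((i : ℕ) : ℝ) + 6) ^ δ)

/-- A path visits `A` and visits the complement of `B` ("the path connects `A` to
`B^c`"). -/
def Crosses {d : ℕ} (p : List (Vert d)) (A B : Set (Vert d)) : Prop :=
  (∃ v ∈ p, v ∈ A) ∧ (∃ v ∈ p, v ∉ B)

/-- Two sets of vertices at mutual `ℓ^∞`-distance at least `r`. -/
def SetDistGE {d : ℕ} (A B : Set (Vert d)) (r : ℝ) : Prop :=
  ∀ a ∈ A, ∀ b ∈ B, r ≤ (linfDist a b : ℝ)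

/-- A proper embedding of the binary tree of depth `k` with base `x`, where tree
vertices of depth `n` are encoded as lists of booleans of length `n` and children
are obtained by appending a bit. -/
def ProperEmbedding {d : ℕ} (δ : ℝ) (ρ K : ℕ) (L0 : ℝ)
    (xseq yseq : ℕ → ℕ → Vert d) (k : ℕ) (x : Vert d) (τ : List Bool → Vert d) : Prop :=
  τ [] = x ∧
  (∀ n, n < k → ∀ σ : List Bool, σ.length = n →
    ∃ i < (2 + rhok ρ K (k - n - 1)) ^ d, ∃ j < 2 * d * (6 + rhok ρ K (k - n - 1)) ^ (d - 1),
      τ (σ ++ [true]) = τ σ + xseq (k - n - 1) i ∧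
      τ (σ ++ [false]) = τ σ + yseq (k - n - 1) j) ∧
  (∀ n, n < k → ∀ σ σ' : List Bool, σ.length = n → σ'.length = k - n →
    (DkSet δ ρ K L0 (k - n) (τ σ) ∩ DkSet δ ρ K L0 0 (τ (σ ++ σ'))).Nonempty)

/-- The countable product measure `ν = μ^{⊗ℕ}` characterised on cylinders. -/
def IsIIDProduct {Ω : Type*} [MeasurableSpace Ω] (μ : Measure Ω)
    (ν : Measure (ℕ → Ω)) : Prop :=
  ∀ (s : Finset ℕ) (f : ℕ → Set Ω), (∀ i ∈ s, MeasurableSet (f i)) →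
    ν {ωt | ∀ i ∈ s, ωt i ∈ f i} = ∏ i ∈ s, μ (f i)

/-- The Lorentz `L(d,1)`-norm of a nonnegative random variable. -/
noncomputable def lorentzNorm {Ω : Type*} [MeasurableSpace Ω] (d : ℕ) (P : Measure Ω)
    (X : Ω → ℝ≥0∞) : ℝ≥0∞ :=
  ∫⁻ s in Set.Ioi (0:ℝ), (P {ω | ENNReal.ofReal s < X ω}) ^ ((1:ℝ) / d)

/-! ## The discrete Gaussian free field -/

/-- The neighbours of a vertex of `ℤ^d`. -/
def nbrs {d : ℕ} (x : Vert d) : Finset (Vert d) :=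
  (Finset.univ : Finset (Fin d × Bool)).image
    (fun p => Function.update x p.1 (x p.1 + if p.2 then 1 else -1))

/-- The number of nearest-neighbour walks of length `n` from `x` to `y`. -/
def nStepCount (d : ℕ) : ℕ → Vert d → Vert d → ℕ
  | 0, x, y => if x = y then 1 else 0
  | n + 1, x, y => ∑ z ∈ nbrs x, nStepCount d n z y

/-- The Green function of the simple random walk on `ℤ^d` (with unit weights). -/
noncomputable def greenSRW (d : ℕ) (x y : Vert d) : ℝ≥0∞ :=
  ∑' n : ℕ, (nStepCount d n x y : ℝ≥0∞) / ((2 * d : ℕ) : ℝ≥0∞) ^ n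

/-- `φ` is a centred Gaussian field with covariance `cov` under `P`, characterised by
the moment generating functions of its finite linear combinations. -/
def IsCenteredGaussianField {d : ℕ} {Ω : Type*} [MeasurableSpace Ω] (P : Measure Ω)
    (φ : Ω → Vert d → ℝ) (cov : Vert d → Vert d → ℝ) : Prop :=
  (∀ x, Measurable fun ω => φ ω x) ∧
  ∀ (s : Finset (Vert d)) (c : Vert d → ℝ) (t : ℝ),
    ∫ ω, Real.exp (t * ∑ x ∈ s, c x * φ ω x) ∂P =
      Real.exp (t ^ 2 * (∑ x ∈ s, ∑ y ∈ s, c x * c y * cov x y) / 2)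

/-- The set `S` of vertices percolates (contains an infinite cluster). -/
def PercolatesIn {d : ℕ} (S : Set (Vert d)) : Prop :=
  ∃ x, {y | VConnectedIn S x y}.Infinite

/-- The critical level `h_*` for level-set percolation of the field `φ`. -/
noncomputable def hstar {d : ℕ} {Ω : Type*} [MeasurableSpace Ω] (P : Measure Ω)
    (φ : Ω → Vert d → ℝ) : ℝ :=
  sSup {h : ℝ | P {ω | PercolatesIn {x | h ≤ φ ω x}} ≠ 0}

/-- `h_f = inf {t : f t = 0}` as an extended real number (`⊤` if `f` has no zero). -/
noncomputable def hfEReal (f : ℝ → ℝ) : EReal :=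
  sInf {x : EReal | ∃ s : ℝ, f s = 0 ∧ x = (s : EReal)}

/-! ## Random conductance models -/

/-- An edge is open for conductances `a` if it is a lattice edge with positive
conductance. -/
def openAdj {d : ℕ} (a : Vert d → Vert d → ℝ) (x y : Vert d) : Prop :=
  adj x y ∧ 0 < a x y

/-- A path using only open edges. -/
def IsOpenPath {d : ℕ} (a : Vert d → Vert d → ℝ) (x y : Vert d) (p : List (Vert d)) :
    Prop :=
  p.head? = some x ∧ p.getLast? = some y ∧ p.Chain' (openAdj a)

/-- Connectivity by open paths. -/
def openConn {d : ℕ} (a : Vert d → Vert d → ℝ) (x y : Vert d) : Prop :=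
  ∃ p, IsOpenPath a x y p

/-- The union of the infinite open clusters (the infinite cluster `C_∞` when it is
unique). -/
def Cinf {d : ℕ} (a : Vert d → Vert d → ℝ) : Set (Vert d) :=
  {x | {y | openConn a x y}.Infinite}

/-- The chemical (graph) distance on the open cluster. -/
noncomputable def chemDist {d : ℕ} (a : Vert d → Vert d → ℝ) (x y : Vert d) : ℝ≥0∞ :=
  ⨅ p : {p : List (Vert d) // IsOpenPath a x y p}, ((p.1.length - 1 : ℕ) : ℝ≥0∞)

/-- The closed ball of radius `r` for the chemical distance. -/
def ballCh {d : ℕ} (a : Vert d → Vert d → ℝ) (x : Vert d) (r : ℝ) : Set (Vert d) :=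
  {y | chemDist a x y ≤ ENNReal.ofReal r}

/-- `μ^ω(x) = Σ_{y∼x} a(x,y)`. -/
noncomputable def muA {d : ℕ} (a : Vert d → Vert d → ℝ) (x : Vert d) : ℝ :=
  ∑ y ∈ nbrs x, a x y

/-- `ν^ω(x) = Σ_{y∼x, a(x,y)>0} a(x,y)⁻¹`. -/
noncomputable def nuA {d : ℕ} (a : Vert d → Vert d → ℝ) (x : Vert d) : ℝ :=
  ∑ y ∈ nbrs x, if 0 < a x y then (a x y)⁻¹ else 0

/-- The space-averaged `ℓ^p`-norm `‖f‖_{p,A}` (maximum norm for `p = ∞`). -/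
noncomputable def avgNormR {d : ℕ} (p : ℝ≥0∞) (A : Set (Vert d)) (f : Vert d → ℝ) : ℝ :=
  if p = ∞ then sSup ((fun x => |f x|) '' A)
  else ((∑' x : A, |f (x : Vert d)| ^ p.toReal) / (A.ncard : ℝ)) ^ (1 / p.toReal)

/-- The sum `Σ_{{y,z} open edge} |f(y) - f(z)|` (each unordered edge counted once). -/
noncomputable def edgeGradSum {d : ℕ} (a : Vert d → Vert d → ℝ) (f : Vert d → ℝ) : ℝ :=
  (1 / 2) * ∑' e : Vert d × Vert d, if openAdj a e.1 e.2 then |f e.2 - f e.1| else 0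

/-- The graph assumption: volume regularity of order `d` and a Sobolev inequality
with exponent `d' ≥ d` on large balls of the infinite cluster. -/
def GraphAssumption {d : ℕ} (d' : ℝ) (a : Vert d → Vert d → ℝ)
    (N4 N5 : Vert d → ℕ) (Creg CS1 : ℝ) : Prop :=
  1 ≤ Creg ∧ 1 ≤ CS1 ∧ (d : ℝ) ≤ d' ∧
  (∀ x ∈ Cinf a, ∀ n : ℕ, N4 x ≤ n →
    Creg⁻¹ * (n : ℝ) ^ d ≤ ((ballCh a x n).ncard : ℝ) ∧
      ((ballCh a x n).ncard : ℝ) ≤ Creg * (n : ℝ) ^ d) ∧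
  (∀ x ∈ Cinf a, ∀ n : ℕ, N5 x ≤ n → ∀ f : Vert d → ℝ,
    (∀ y, f y ≠ 0 → y ∈ ballCh a x n) →
    avgNormR (ENNReal.ofReal (d' / (d' - 1))) (ballCh a x n) f ≤
      CS1 * n / ((ballCh a x n).ncard : ℝ) * edgeGradSum a f)

/-- The generator `(ℒ f)(x) = Σ_{y∼x} a(x,y)(f(y)-f(x)) - h κ(x) f(x)`. -/
noncomputable def genL {d : ℕ} (a : Vert d → Vert d → ℝ) (κ : Vert d → ℝ) (h : ℝ)
    (f : Vert d → ℝ) (x : Vert d) : ℝ :=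
  (∑ y ∈ nbrs x, a x y * (f y - f x)) - h * κ x * f x

/-- The carré du champ `Γ(f,g)(x) = Σ_{y∼x} a(x,y)(f(y)-f(x))(g(y)-g(x))`. -/
noncomputable def carre {d : ℕ} (a : Vert d → Vert d → ℝ) (f g : Vert d → ℝ)
    (x : Vert d) : ℝ :=
  ∑ y ∈ nbrs x, a x y * (f y - f x) * (g y - g x)

/-- The weighted carré du champ
`Γ_η(f,g)(x) = Σ_{y∼x} av(η²)({x,y}) a(x,y)(f(y)-f(x))(g(y)-g(x))`. -/
noncomputable def carreEta {d : ℕ} (a : Vert d → Vert d → ℝ) (η f g : Vert d → ℝ)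
    (x : Vert d) : ℝ :=
  ∑ y ∈ nbrs x, ((η x ^ 2 + η y ^ 2) / 2) * (a x y * (f y - f x) * (g y - g x))

/-- The Dirichlet form `E(f) = ⟨∇f, a ∇f⟩ + h ⟨f, κ f⟩`. -/
noncomputable def dirichletE {d : ℕ} (a : Vert d → Vert d → ℝ) (κ : Vert d → ℝ)
    (h : ℝ) (f : Vert d → ℝ) : ℝ :=
  (1 / 2) * (∑' e : Vert d × Vert d,
      if adj e.1 e.2 then a e.1 e.2 * (f e.2 - f e.1) ^ 2 else 0) +
    h * ∑' x, κ x * f x ^ 2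

/-- `g` is the Green function on `C` of the walk with conductances `a` and killing
measure `h·κ`: the minimal nonnegative fundamental solution of `ℒ g(·,y) = -𝟙_y`. -/
def IsGreenFn {d : ℕ} (a : Vert d → Vert d → ℝ) (κ : Vert d → ℝ) (h : ℝ)
    (C : Set (Vert d)) (g : Vert d → Vert d → ℝ) : Prop :=
  (∀ x y, 0 ≤ g x y) ∧
  (∀ y ∈ C, ∀ x ∈ C, genL a κ h (fun z => g z y) x = -(if x = y then (1:ℝ) else 0)) ∧
  (∀ g' : Vert d → Vert d → ℝ, (∀ x y, 0 ≤ g' x y) →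
    (∀ y ∈ C, ∀ x ∈ C, genL a κ h (fun z => g' z y) x ≤ -(if x = y then (1:ℝ) else 0)) →
    ∀ x ∈ C, ∀ y ∈ C, g x y ≤ g' x y)

/-- `q t x y = P_x(X_t = y)` is the (minimal) transition function of the Markov chain
with jump rates `a(x,y)/θ(x)`, characterised via the backward Kolmogorov equations. -/
def IsHeatSemigroup {d : ℕ} (a : Vert d → Vert d → ℝ) (θ : Vert d → ℝ)
    (q : ℝ → Vert d → Vert d → ℝ) : Prop :=
  (∀ x y, q 0 x y = if x = y then (1:ℝ) else 0) ∧
  (∀ t x y, 0 ≤ q t x y) ∧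
  (∀ t x, ∑' y, q t x y ≤ 1) ∧
  (∀ x y, ∀ t : ℝ, 0 ≤ t →
    HasDerivAt (fun s => q s x y) (∑ z ∈ nbrs x, a x z / θ x * (q t z y - q t x y)) t) ∧
  (∀ q' : ℝ → Vert d → Vert d → ℝ,
    (∀ x y, q' 0 x y = if x = y then (1:ℝ) else 0) →
    (∀ t x y, 0 ≤ q' t x y) →
    (∀ x y, ∀ t : ℝ, 0 ≤ t →
      HasDerivAt (fun s => q' s x y)
        (∑ z ∈ nbrs x, a x z / θ x * (q' t z y - q' t x y)) t) →
    ∀ t : ℝ, 0 ≤ t → ∀ x y, q t x y ≤ q' t x y)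

/-- The FPP edge weight `(1 ∧ (κ(x) ∧ κ(y))/a(x,y))^{1/2}` (equal to `∞` on closed
edges); used both for the metric `d_κ` and, with `θ` in place of `κ`, for `d_θ`. -/
noncomputable def kapWeightE {d : ℕ} (a : Vert d → Vert d → ℝ) (κ : Vert d → ℝ)
    (x y : Vert d) : ℝ≥0∞ :=
  if 0 < a x y then ENNReal.ofReal (Real.sqrt (min 1 (min (κ x) (κ y) / a x y))) else ∞

/-- The FPP-type metric `d_κ` on the open cluster. -/
noncomputable def dkap {d : ℕ} (a : Vert d → Vert d → ℝ) (κ : Vert d → ℝ)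
    (x y : Vert d) : ℝ≥0∞ :=
  ⨅ p : {p : List (Vert d) // IsOpenPath a x y p},
    ((edgesOf p.1).map fun e => kapWeightE a κ e.1 e.2).sum

/-- `F_γ(r) = (1+r)^γ (1+1/r)^{1/2}` in `ℝ≥0∞` (so `F_γ(0) = ∞`). -/
noncomputable def FgamE (γ r : ℝ) : ℝ≥0∞ :=
  (1 + ENNReal.ofReal r) ^ γ * (1 + (ENNReal.ofReal r)⁻¹) ^ ((1:ℝ) / 2)

/-- The open cluster of `x` has `ℓ^1`-diameter at least `r`. -/
def clusterDiamGE {d : ℕ} (a : Vert d → Vert d → ℝ) (x : Vert d) (r : ℝ) : Prop :=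
  ∃ y z, openConn a x y ∧ openConn a x z ∧ r ≤ (l1Dist y z : ℝ)

/-- Condition **S1** (local uniqueness of large clusters). -/
def CondS1 {d : ℕ} {Γ : Type*} [MeasurableSpace Γ]
    (P : ℝ → Measure (Config d Γ)) (I : Set ℝ)
    (aC : Config d Γ → Vert d → Vert d → ℝ) : Prop :=
  ∃ fS : ℝ → ℕ → ℝ, ∀ u ∈ I, ∃ ΔS RS : ℝ, 0 < ΔS ∧
    (∀ R : ℕ, RS ≤ R → Real.log (R : ℝ) ^ (1 + ΔS) ≤ fS u R) ∧
    ∀ R : ℕ, 1 ≤ R →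
      (ENNReal.ofReal (1 - Real.exp (-(fS u R))) ≤
        P u {ω | ∃ x ∈ cubeVerts (0 : Vert d) (R : ℝ), clusterDiamGE (aC ω) x (R : ℝ)}) ∧
      (ENNReal.ofReal (1 - Real.exp (-(fS u R))) ≤
        P u {ω | ∀ x ∈ cubeVerts (0 : Vert d) (R : ℝ), ∀ y ∈ cubeVerts (0 : Vert d) (R : ℝ),
          clusterDiamGE (aC ω) x ((R : ℝ) / 10) → clusterDiamGE (aC ω) y ((R : ℝ) / 10) →
          ∃ p, IsOpenPath (aC ω) x y p ∧ ∀ v ∈ p, v ∈ cubeVerts (0 : Vert d) ((2 * R : ℕ) : ℝ)})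

/-- Condition **S2**: `u ↦ P^u(0 ∈ C_∞)` is positive and continuous on `I`. -/
def CondS2 {d : ℕ} {Γ : Type*} [MeasurableSpace Γ]
    (P : ℝ → Measure (Config d Γ)) (I : Set ℝ)
    (aC : Config d Γ → Vert d → Vert d → ℝ) : Prop :=
  (∀ u ∈ I, 0 < P u {ω | (0 : Vert d) ∈ Cinf (aC ω)}) ∧
  ContinuousOn (fun u => (P u {ω | (0 : Vert d) ∈ Cinf (aC ω)}).toReal) I

/-- Weighted `p`-th moment `E[X^p w]` (essential supremum of `X` for `p = ∞`). -/
noncomputable def wMoment {Ω : Type*} [MeasurableSpace Ω] (μm : Measure Ω) (p : ℝ≥0∞)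
    (X w : Ω → ℝ≥0∞) : ℝ≥0∞ :=
  if p = ∞ then essSup X μm else ∫⁻ ω, X ω ^ p.toReal * w ω ∂μm

/-- `p_* = p/(p-1)` (with `∞_* = 1`). -/
noncomputable def pstar (p : ℝ≥0∞) : ℝ≥0∞ :=
  if p = ∞ then 1 else ENNReal.ofReal (p.toReal / (p.toReal - 1))

/-- `‖∇η‖_{ℓ^∞(E)}`: the supremum of `|η(y)-η(x)|` over open edges. -/
noncomputable def gradSup {d : ℕ} (a : Vert d → Vert d → ℝ) (η : Vert d → ℝ) : ℝ :=
  sSup {r : ℝ | ∃ x y, openAdj a x y ∧ r = |η y - η x|}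

/-- `exp(-ζ x)` for `x ∈ ℝ≥0∞` (equal to `0` at `x = ∞`). -/
noncomputable def expNegE (ζ : ℝ) (x : ℝ≥0∞) : ℝ≥0∞ :=
  if x = ∞ then 0 else ENNReal.ofReal (Real.exp (-(ζ * x.toReal)))

/-- The `m^ω(n)` factor of the maximal inequality. -/
noncomputable def mBound {d : ℕ} (a : Vert d → Vert d → ℝ) (p q : ℝ≥0∞)
    (phi : Vert d → ℝ) (x0 : Vert d) (n : ℕ) : ℝ :=
  avgNormR p (ballCh a x0 (n : ℝ)) (fun x => max 1 (muA a x)) *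
    avgNormR q (ballCh a x0 (n : ℝ)) (fun x => max 1 (nuA a x)) *
    (1 + avgNormR p (ballCh a x0 (n : ℝ)) (carre a phi fun z => (phi z)⁻¹) * (n : ℝ) ^ 2)

/-- The Caccioppoli estimate with constant `c35` (for the data `a`, `κ`, `h`). -/
def CaccEst {d : ℕ} (a : Vert d → Vert d → ℝ) (κ : Vert d → ℝ) (h : ℝ) (c35 : ℝ) :
    Prop :=
  ∀ B : Set (Vert d), B.Finite → B ⊆ Cinf a →
    (∀ x ∈ B, ∀ y ∈ B, ∃ p, IsOpenPath a x y p ∧ ∀ v ∈ p, v ∈ B) →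
  ∀ η : Vert d → ℝ, (∀ x, η x ∈ Set.Icc (0:ℝ) 1) → (∀ x, η x ≠ 0 → x ∈ B) →
    (∀ x ∈ B, (∃ y, y ∉ B ∧ openAdj a x y) → η x = 0) →
  ∀ u : Vert d → ℝ, (∀ x, 0 ≤ u x) → (∀ x ∈ B, 0 ≤ genL a κ h u x) →
  ∀ phi : Vert d → ℝ, (∀ x, 0 < phi x) →
  ∀ α : ℝ, 1 ≤ α →
    dirichletE a κ h (fun x => η x * (phi x * u x) ^ α) ≤
      c35 * α ^ 2 * ∑' x, (phi x * u x) ^ (2 * α) *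
        (carre a η η x - carreEta a η phi (fun z => (phi z)⁻¹) x)



/-! ## Elementary inequalities -/

lemma rpow_sub_le_bern {a b s : ℝ} (ha : 0 ≤ a) (hab : a ≤ b) (hs : 1 ≤ s) :
    b ^ s - a ^ s ≤ s * b ^ (s - 1) * (b - a) := by
  rcases eq_or_lt_of_le (ha.trans hab) with hb | hb
  · have : a = 0 := le_antisymm (hab.trans hb.symm.le) ha
    subst this; subst hb; simp
  have h1 := one_add_mul_self_le_rpow_one_add (s := a / b - 1) (by
    have : 0 ≤ a / b := by positivity
    linarith) hs
  have h2 : (1 + (a / b - 1)) = a / b := by ring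
  rw [h2, Real.div_rpow ha hb.le] at h1
  have hbs : 0 < b ^ s := Real.rpow_pos_of_pos hb s
  rw [le_div_iff₀ hbs] at h1
  have h3 : b ^ s = b ^ (s - 1) * b := by
    rw [← Real.rpow_add_one hb.ne']; ring_nf
  have h4 : (1 + s * (a / b - 1)) * b ^ s = b ^ s - s * b ^ (s - 1) * (b - a) := by
    rw [h3]; field_simp; ring
  linarith

set_option maxHeartbeats 1000000 in
/-- Algebraic core of the Caccioppoli estimate. -/
lemma edge_alg {α η1 η2 V W Q1 Q2 D S : ℝ} (hα : 1 ≤ α) (h1 : 0 ≤ η1) (h2 : 0 ≤ η2)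
    (hW : 0 ≤ W) (hWV : W ≤ V) (hq1 : W ^ 2 ≤ Q1) (hq2 : Q1 ≤ V * W) (hq3 : V * W ≤ Q2)
    (hq4 : Q2 ≤ V ^ 2) (hG : (V - W) ^ 2 ≤ α * (V ^ 2 - Q2 - Q1 + W ^ 2))
    (hD : 0 ≤ D) (hS : S ^ 2 = D + D ^ 2 / 4) :
    (η2 * V - η1 * W) ^ 2 ≤ 4 * α * (η2 ^ 2 * V ^ 2 + η1 ^ 2 * W ^ 2
        - (1 + D / 2 + S) * (η2 ^ 2 * Q2) - (1 + D / 2 - S) * (η1 ^ 2 * Q1))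
      + 40 * α ^ 2 * ((η2 - η1) ^ 2 + (η1 ^ 2 + η2 ^ 2) * D) * (V ^ 2 + W ^ 2) := by
  have hV : 0 ≤ V := hW.trans hWV
  obtain ⟨δ, hδ, hδD⟩ : ∃ δ : ℝ, 0 ≤ δ ∧ δ ^ 2 = D := ⟨√D, Real.sqrt_nonneg _, Real.sq_sqrt hD⟩
  subst hδD
  obtain ⟨e, he⟩ : ∃ e, e = |η2 - η1| := ⟨_, rfl⟩
  have he0 : 0 ≤ e := he ▸ abs_nonneg _
  have he2 : e ^ 2 = (η2 - η1) ^ 2 := by rw [he, sq_abs]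
  have hea : |η2 ^ 2 - η1 ^ 2| = e * (η1 + η2) := by
    rw [he, show η2 ^ 2 - η1 ^ 2 = (η2 - η1) * (η1 + η2) by ring, abs_mul,
      abs_of_nonneg (add_nonneg h1 h2)]
  obtain ⟨G, hGd⟩ : ∃ G, G = V - W := ⟨_, rfl⟩
  have hG0 : 0 ≤ G := by linarith
  have hVG : V ^ 2 - Q2 ≤ V * G := by rw [hGd]; nlinarith
  have hs2 : η1 + η2 ≤ 2 * η1 + e := by
    have := le_abs_self (η2 - η1); rw [← he] at this; linarith
  -- main part
  have t1 : η1 ^ 2 * G ^ 2 ≤ α * (η1 ^ 2 * (V ^ 2 + W ^ 2 - Q1 - Q2)) := by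
    have := mul_le_mul_of_nonneg_left hG (sq_nonneg η1)
    rw [hGd]; nlinarith
  have t2 : -(e * (η1 + η2) * (V * G)) ≤ (η2 ^ 2 - η1 ^ 2) * (V ^ 2 - Q2) := by
    have a1 : |(η2 ^ 2 - η1 ^ 2) * (V ^ 2 - Q2)| ≤ e * (η1 + η2) * (V * G) := by
      rw [abs_mul, hea, abs_of_nonneg (by linarith : 0 ≤ V ^ 2 - Q2)]
      exact mul_le_mul_of_nonneg_left hVG (by positivity)
    linarith [neg_abs_le ((η2 ^ 2 - η1 ^ 2) * (V ^ 2 - Q2))]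
  have hQ1 : 0 ≤ Q1 := (sq_nonneg W).trans hq1
  have hQ2 : 0 ≤ Q2 := (mul_nonneg hV hW).trans hq3
  have hQ1V : Q1 ≤ V ^ 2 := by nlinarith
  have t3 : η2 ^ 2 * Q2 + η1 ^ 2 * Q1 ≤ (η1 ^ 2 + η2 ^ 2) * V ^ 2 := by
    have := mul_le_mul_of_nonneg_left hq4 (sq_nonneg η2)
    have := mul_le_mul_of_nonneg_left hQ1V (sq_nonneg η1)
    linarith
  have hab : |η2 ^ 2 * Q2 - η1 ^ 2 * Q1| ≤ e * (η1 + η2) * V ^ 2 + η1 ^ 2 * (2 * V * G) := by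
    have : η2 ^ 2 * Q2 - η1 ^ 2 * Q1 = (η2 ^ 2 - η1 ^ 2) * Q2 + η1 ^ 2 * (Q2 - Q1) := by ring
    rw [this]
    refine (abs_add_le _ _).trans (add_le_add ?_ ?_)
    · rw [abs_mul, hea, abs_of_nonneg hQ2]
      exact mul_le_mul_of_nonneg_left hq4 (by positivity)
    · rw [abs_mul, abs_of_nonneg (sq_nonneg η1), abs_of_nonneg (by linarith : 0 ≤ Q2 - Q1)]
      refine mul_le_mul_of_nonneg_left ?_ (sq_nonneg η1)
      rw [hGd]; nlinarith
  have hab2 : |η2 ^ 2 * Q2 - η1 ^ 2 * Q1| ≤ (η1 ^ 2 + η2 ^ 2) * V ^ 2 := by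
    have p1 : 0 ≤ η2 ^ 2 * Q2 := by positivity
    have p2 : 0 ≤ η1 ^ 2 * Q1 := by positivity
    rw [abs_le]; constructor <;> linarith
  have hSabs : |S| ≤ δ + δ ^ 2 / 2 := by
    apply abs_le_of_sq_le_sq _ (by positivity)
    rw [hS]; nlinarith [pow_nonneg hδ 3]
  have t4 : S * (η2 ^ 2 * Q2 - η1 ^ 2 * Q1) ≤
      δ * (e * (η1 + η2) * V ^ 2 + η1 ^ 2 * (2 * V * G))
        + δ ^ 2 / 2 * ((η1 ^ 2 + η2 ^ 2) * V ^ 2) := by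
    calc S * (η2 ^ 2 * Q2 - η1 ^ 2 * Q1) ≤ |S| * |η2 ^ 2 * Q2 - η1 ^ 2 * Q1| := by
          rw [← abs_mul]; exact le_abs_self _
      _ ≤ (δ + δ ^ 2 / 2) * |η2 ^ 2 * Q2 - η1 ^ 2 * Q1| := by gcongr
      _ ≤ _ := by
          rw [add_mul]
          exact add_le_add (mul_le_mul_of_nonneg_left hab hδ)
            (mul_le_mul_of_nonneg_left hab2 (by positivity))
  -- Young
  have y1 : e * (η1 + η2) * (V * G) * α ≤ η1 ^ 2 * G ^ 2 / 4 + 4 * α ^ 2 * (e ^ 2 * V ^ 2)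
      + α * (e ^ 2 * V ^ 2) := by
    have b1 : e * (η1 + η2) * (V * G) ≤ e * (2 * η1 + e) * (V * G) := by gcongr
    have b2 : e ^ 2 * (V * G) ≤ e ^ 2 * V ^ 2 := by
      refine mul_le_mul_of_nonneg_left ?_ (sq_nonneg e)
      rw [hGd]; nlinarith
    have b3 := mul_le_mul_of_nonneg_right b1 (by linarith : 0 ≤ α)
    have b4 := mul_le_mul_of_nonneg_right b2 (by linarith : 0 ≤ α)
    have b5 : η1 ^ 2 * G ^ 2 / 4 + 4 * α ^ 2 * (e ^ 2 * V ^ 2) + e ^ 2 * (V * G) * α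
        - e * (2 * η1 + e) * (V * G) * α = (η1 * G / 2 - 2 * α * e * V) ^ 2 := by ring
    have b6 := sq_nonneg (η1 * G / 2 - 2 * α * e * V)
    rw [← b5] at b6
    linarith
  have y2 : δ * (e * (η1 + η2) * V ^ 2) ≤ e ^ 2 * V ^ 2 / 2 + δ ^ 2 * ((η1 ^ 2 + η2 ^ 2) * V ^ 2) := by
    have c1 : δ * (e * (η1 + η2)) ≤ e ^ 2 / 2 + δ ^ 2 * (η1 ^ 2 + η2 ^ 2) := by
      have c2 : e ^ 2 / 2 + δ ^ 2 * (η1 ^ 2 + η2 ^ 2) - δ * (e * (η1 + η2)) =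
        (e - δ * (η1 + η2)) ^ 2 / 2 + δ ^ 2 * (η1 - η2) ^ 2 / 2 := by ring
      have c3 : 0 ≤ (e - δ * (η1 + η2)) ^ 2 / 2 + δ ^ 2 * (η1 - η2) ^ 2 / 2 := by positivity
      linarith
    have c4 := mul_le_mul_of_nonneg_right c1 (sq_nonneg V)
    linarith
  have y3 : δ * (η1 ^ 2 * (2 * V * G)) * α ≤ η1 ^ 2 * G ^ 2 / 4 + 4 * α ^ 2 * (δ ^ 2 * (η1 ^ 2 * V ^ 2)) := by
    have b5 : η1 ^ 2 * G ^ 2 / 4 + 4 * α ^ 2 * (δ ^ 2 * (η1 ^ 2 * V ^ 2))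
        - δ * (η1 ^ 2 * (2 * V * G)) * α = (η1 * G / 2 - 2 * α * δ * η1 * V) ^ 2 := by ring
    have b6 := sq_nonneg (η1 * G / 2 - 2 * α * δ * η1 * V)
    rw [← b5] at b6
    linarith
  have f1 : (η2 * V - η1 * W) ^ 2 ≤ 2 * (η1 ^ 2 * G ^ 2) + 2 * (e ^ 2 * V ^ 2) := by
    rw [he2, hGd]
    have b6 := sq_nonneg (η1 * (V - W) - (η2 - η1) * V)
    linarith
  obtain ⟨E, hE⟩ : ∃ E, E = e ^ 2 * V ^ 2 := ⟨_, rfl⟩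
  obtain ⟨H, hH⟩ : ∃ H, H = δ ^ 2 * ((η1 ^ 2 + η2 ^ 2) * V ^ 2) := ⟨_, rfl⟩
  rw [← hE] at y1 y2 f1
  rw [← hH] at y2
  have hE0 : 0 ≤ E := by rw [hE]; positivity
  have hH0 : 0 ≤ H := by rw [hH]; positivity
  have hH1 : δ ^ 2 * (η1 ^ 2 * V ^ 2) ≤ H := by
    rw [hH]; nlinarith [mul_nonneg (sq_nonneg δ) (mul_nonneg (sq_nonneg η2) (sq_nonneg V))]
  have hα0 : 0 ≤ α := by linarith
  have hα2 : α ≤ α ^ 2 := by nlinarith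
  have hα3 : 1 ≤ α ^ 2 := by nlinarith
  have u2 := mul_le_mul_of_nonneg_right t2 hα0
  have u3 := mul_le_mul_of_nonneg_right (mul_le_mul_of_nonneg_left t3 (sq_nonneg δ)) hα0
  have u4 := mul_le_mul_of_nonneg_right t4 hα0
  have u5 := mul_le_mul_of_nonneg_right y2 hα0
  have u6 := mul_le_mul_of_nonneg_left hH1 (sq_nonneg α)
  have final : (η2 * V - η1 * W) ^ 2 ≤ 4 * α * (η2 ^ 2 * V ^ 2 + η1 ^ 2 * W ^ 2
        - (1 + δ ^ 2 / 2 + S) * (η2 ^ 2 * Q2) - (1 + δ ^ 2 / 2 - S) * (η1 ^ 2 * Q1))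
      + 40 * α ^ 2 * (E + H) := by
    have e1 : α * E ≤ α ^ 2 * E := mul_le_mul_of_nonneg_right hα2 hE0
    have e2 : α * H ≤ α ^ 2 * H := mul_le_mul_of_nonneg_right hα2 hH0
    have e3 : E ≤ α ^ 2 * E := le_mul_of_one_le_left hE0 hα3
    have e4 : H ≤ α ^ 2 * H := le_mul_of_one_le_left hH0 hα3
    have hHe : δ ^ 2 * ((η1 ^ 2 + η2 ^ 2) * V ^ 2) = H := hH.symm
    have hHe2 : δ ^ 2 / 2 * ((η1 ^ 2 + η2 ^ 2) * V ^ 2) * α = H * α / 2 := by rw [hH]; ring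
    have key : α * (η2 ^ 2 * V ^ 2 + η1 ^ 2 * W ^ 2
        - (1 + δ ^ 2 / 2 + S) * (η2 ^ 2 * Q2) - (1 + δ ^ 2 / 2 - S) * (η1 ^ 2 * Q1))
        = α * (η1 ^ 2 * (V ^ 2 + W ^ 2 - Q1 - Q2)) + (η2 ^ 2 - η1 ^ 2) * (V ^ 2 - Q2) * α
          - δ ^ 2 * (η2 ^ 2 * Q2 + η1 ^ 2 * Q1) * α / 2
          - S * (η2 ^ 2 * Q2 - η1 ^ 2 * Q1) * α := by ring
    have u2' : -(e * (η1 + η2) * (V * G) * α) ≤ (η2 ^ 2 - η1 ^ 2) * (V ^ 2 - Q2) * α := by linarith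
    have u4' : S * (η2 ^ 2 * Q2 - η1 ^ 2 * Q1) * α ≤ δ * (e * (η1 + η2) * V ^ 2) * α
        + δ * (η1 ^ 2 * (2 * V * G)) * α + H * α / 2 := by linarith
    rw [hHe] at u3
    rw [mul_assoc 4 α, key]
    linarith only [t1, u2', u3, u4', u5, u6, y1, y3, f1, e1, e2, e3, e4, hE0, hH0]
  refine final.trans ?_
  have : E + H ≤ ((η2 - η1) ^ 2 + (η1 ^ 2 + η2 ^ 2) * δ ^ 2) * (V ^ 2 + W ^ 2) := by
    rw [hE, hH, he2]
    have z : 0 ≤ ((η2 - η1) ^ 2 + (η1 ^ 2 + η2 ^ 2) * δ ^ 2) * W ^ 2 := by positivity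
    linarith
  have := mul_le_mul_of_nonneg_left this (by positivity : 0 ≤ 40 * α ^ 2)
  linarith

/-- Edge-wise Caccioppoli inequality, ordered version. -/
lemma edge_ineq_aux {α η1 η2 v1 v2 r : ℝ} (hα : 1 ≤ α) (h1 : 0 ≤ η1) (h2 : 0 ≤ η2)
    (hv1 : 0 ≤ v1) (hv : v1 ≤ v2) (hr : 0 < r) :
    (η2 * v2 ^ α - η1 * v1 ^ α) ^ 2 ≤
      4 * α * (η2 ^ 2 * v2 ^ (2 * α) + η1 ^ 2 * v1 ^ (2 * α)
        - r * (η2 ^ 2 * (v2 ^ (2 * α - 1) * v1)) - r⁻¹ * (η1 ^ 2 * (v1 ^ (2 * α - 1) * v2)))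
      + 40 * α ^ 2 * ((η2 - η1) ^ 2 + (η1 ^ 2 + η2 ^ 2) * (r + r⁻¹ - 2)) *
          (v2 ^ (2 * α) + v1 ^ (2 * α)) := by
  have hv2 : 0 ≤ v2 := hv1.trans hv
  have hα0 : 0 < α := by linarith
  have sqe : ∀ v : ℝ, 0 ≤ v → v ^ (2 * α) = (v ^ α) ^ 2 := fun v hv => by
    rw [mul_comm, Real.rpow_mul hv]; norm_num
  have pe : ∀ v : ℝ, 0 ≤ v → v ^ (2 * α - 1) = v ^ (α - 1) * v ^ α := fun v hv => by
    rw [← Real.rpow_add_of_nonneg hv (by linarith) hα0.le]; ring_nf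
  have pe1 : ∀ v : ℝ, 0 ≤ v → v ^ α = v ^ (α - 1) * v := fun v hv => by
    conv_rhs => rw [← Real.rpow_one v, ← Real.rpow_mul hv, one_mul]
    rw [← Real.rpow_add_of_nonneg hv (by linarith) zero_le_one]; ring_nf
  have hr1 : r * r⁻¹ = 1 := mul_inv_cancel₀ hr.ne'
  have hp := Real.rpow_le_rpow hv1 hv (by linarith : 0 ≤ α - 1)
  have hpα := Real.rpow_le_rpow hv1 hv hα0.le
  have p1 : 0 ≤ v1 ^ (α - 1) := Real.rpow_nonneg hv1 _
  have p2 : 0 ≤ v2 ^ (α - 1) := Real.rpow_nonneg hv2 _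
  have q1 : 0 ≤ v1 ^ α := Real.rpow_nonneg hv1 _
  have q2 : 0 ≤ v2 ^ α := Real.rpow_nonneg hv2 _
  have bern := rpow_sub_le_bern hv1 hv hα
  have e1 := pe1 v1 hv1
  have e2 := pe1 v2 hv2
  have m1 : v1 ^ α ≤ v1 ^ (α - 1) * v2 := by rw [e1]; gcongr
  have m2 : v1 ^ (α - 1) * v2 ≤ v2 ^ α := by rw [e2]; gcongr
  have m3 : v1 ^ α ≤ v2 ^ (α - 1) * v1 := by rw [e1]; gcongr
  have m4 : v2 ^ (α - 1) * v1 ≤ v2 ^ α := by rw [e2]; gcongr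
  have := edge_alg (α := α) (η1 := η1) (η2 := η2) (V := v2 ^ α) (W := v1 ^ α)
    (Q1 := v1 ^ (2 * α - 1) * v2) (Q2 := v2 ^ (2 * α - 1) * v1) (D := r + r⁻¹ - 2)
    (S := (r - r⁻¹) / 2) hα h1 h2 q1 hpα
    (by rw [pe v1 hv1]; nlinarith) (by rw [pe v1 hv1]; nlinarith)
    (by rw [pe v2 hv2]; nlinarith) (by rw [pe v2 hv2]; nlinarith)
    (by
      rw [pe v1 hv1, pe v2 hv2]
      set V := v2 ^ α
      set W := v1 ^ α
      set x := v2 ^ (α - 1)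
      set y := v1 ^ (α - 1)
      have hVW : 0 ≤ V - W := by linarith
      have a1 : (V - W) ^ 2 ≤ α * (x * (v2 - v1)) * (V - W) := by
        nlinarith
      have a2 : x * (V - W) ≤ x * V - y * W := by nlinarith
      have a3 : (v2 - v1) * (x * (V - W)) ≤ (v2 - v1) * (x * V - y * W) :=
        mul_le_mul_of_nonneg_left a2 (by linarith)
      have a4 : V ^ 2 - x * V * v1 - y * W * v2 + W ^ 2 = (v2 - v1) * (x * V - y * W) := by
        have : V ^ 2 = (x * v2) * V := by rw [← e2]; ring
        rw [this]
        have : W ^ 2 = (y * v1) * W := by rw [← e1]; ring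
        rw [this]; ring
      rw [a4]
      have := mul_le_mul_of_nonneg_left a3 hα0.le
      nlinarith)
    (by
      have : r + r⁻¹ - 2 = (r - 1) ^ 2 * r⁻¹ := by
        field_simp; ring
      rw [this]; positivity)
    (by nlinarith)
  rw [sqe v1 hv1, sqe v2 hv2]
  convert this using 3
  ring

/-- Edge-wise Caccioppoli inequality. -/
lemma edge_ineq {α η1 η2 v1 v2 r : ℝ} (hα : 1 ≤ α) (h1 : 0 ≤ η1) (h2 : 0 ≤ η2)
    (hv1 : 0 ≤ v1) (hv2 : 0 ≤ v2) (hr : 0 < r) :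
    (η2 * v2 ^ α - η1 * v1 ^ α) ^ 2 ≤
      4 * α * (η2 ^ 2 * v2 ^ (2 * α) + η1 ^ 2 * v1 ^ (2 * α)
        - r * (η2 ^ 2 * (v2 ^ (2 * α - 1) * v1)) - r⁻¹ * (η1 ^ 2 * (v1 ^ (2 * α - 1) * v2)))
      + 40 * α ^ 2 * ((η2 - η1) ^ 2 + (η1 ^ 2 + η2 ^ 2) * (r + r⁻¹ - 2)) *
          (v2 ^ (2 * α) + v1 ^ (2 * α)) := by
  rcases le_total v1 v2 with h | h
  · exact edge_ineq_aux hα h1 h2 hv1 h hr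
  · have := edge_ineq_aux (r := r⁻¹) hα h2 h1 hv2 h (inv_pos.2 hr)
    rw [inv_inv] at this
    nlinarith

/-- Summation by parts on a finite set. -/
lemma sum_by_parts {ι : Type*} (F : Finset ι) (c : ι → ι → ℝ) (hs : ∀ x y, c x y = c y x)
    (w u : ι → ℝ) :
    ∑ x ∈ F, ∑ y ∈ F, c x y * ((w y - w x) * (u y - u x)) =
      -2 * ∑ x ∈ F, w x * ∑ y ∈ F, c x y * (u y - u x) := by
  have h1 : ∑ x ∈ F, ∑ y ∈ F, c x y * (w y * (u y - u x)) =
      - ∑ x ∈ F, ∑ y ∈ F, c x y * (w x * (u y - u x)) := by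
    rw [Finset.sum_comm, ← Finset.sum_neg_distrib]
    refine Finset.sum_congr rfl fun x _ => ?_
    rw [← Finset.sum_neg_distrib]
    refine Finset.sum_congr rfl fun y _ => ?_
    rw [hs y x]; ring
  have h2 : ∑ x ∈ F, w x * ∑ y ∈ F, c x y * (u y - u x) =
      ∑ x ∈ F, ∑ y ∈ F, c x y * (w x * (u y - u x)) := by
    refine Finset.sum_congr rfl fun x _ => ?_
    rw [Finset.mul_sum]
    refine Finset.sum_congr rfl fun y _ => ?_
    ring
  have h3 : ∑ x ∈ F, ∑ y ∈ F, c x y * ((w y - w x) * (u y - u x)) =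
      ∑ x ∈ F, ∑ y ∈ F, c x y * (w y * (u y - u x)) -
      ∑ x ∈ F, ∑ y ∈ F, c x y * (w x * (u y - u x)) := by
    simp only [← Finset.sum_sub_distrib]
    refine Finset.sum_congr rfl fun x _ => Finset.sum_congr rfl fun y _ => ?_
    ring
  rw [h3, h1, h2]; ring

/-- The Caccioppoli estimate on a finite weighted graph. -/
lemma cacc {ι : Type*} (F : Finset ι) (c : ι → ι → ℝ) (hs : ∀ x y, c x y = c y x)
    (hc : ∀ x y, 0 ≤ c x y) (u φ η : ι → ℝ) (hu : ∀ x, 0 ≤ u x) (hφ : ∀ x, 0 < φ x)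
    (hη : ∀ x, 0 ≤ η x) (hsub : ∀ x ∈ F, η x ≠ 0 → 0 ≤ ∑ y ∈ F, c x y * (u y - u x))
    {α : ℝ} (hα : 1 ≤ α) :
    ∑ x ∈ F, ∑ y ∈ F, c x y * (η y * (φ y * u y) ^ α - η x * (φ x * u x) ^ α) ^ 2 ≤
      80 * α ^ 2 * ∑ x ∈ F, ∑ y ∈ F, c x y * (((η y - η x) ^ 2 +
        (η x ^ 2 + η y ^ 2) * (-((φ y - φ x) * ((φ y)⁻¹ - (φ x)⁻¹)))) *
          (φ x * u x) ^ (2 * α)) := by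
  set w : ι → ℝ := fun x => η x ^ 2 * φ x * (φ x * u x) ^ (2 * α - 1) with hw
  set R : ι → ι → ℝ := fun x y => (η y - η x) ^ 2 +
        (η x ^ 2 + η y ^ 2) * (-((φ y - φ x) * ((φ y)⁻¹ - (φ x)⁻¹))) with hR
  have hRs : ∀ x y, R x y = R y x := fun x y => by simp only [hR]; ring
  have hv : ∀ x, 0 ≤ φ x * u x := fun x => mul_nonneg (hφ x).le (hu x)
  have hwn : ∀ x, 0 ≤ w x := fun x =>
    mul_nonneg (mul_nonneg (sq_nonneg _) (hφ x).le) (Real.rpow_nonneg (hv x) _)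
  have hpow : ∀ x, (φ x * u x) ^ (2 * α) = (φ x * u x) ^ (2 * α - 1) * (φ x * u x) := fun x => by
    conv_rhs => rw [← Real.rpow_one (φ x * u x), ← Real.rpow_mul (hv x), one_mul]
    rw [← Real.rpow_add_of_nonneg (hv x) (by linarith) zero_le_one]; ring_nf
  have key : ∀ x y, c x y * (η y * (φ y * u y) ^ α - η x * (φ x * u x) ^ α) ^ 2 ≤
      4 * α * (c x y * ((w y - w x) * (u y - u x))) +
      40 * α ^ 2 * (c x y * (R x y * (φ x * u x) ^ (2 * α))) +
      40 * α ^ 2 * (c y x * (R y x * (φ y * u y) ^ (2 * α))) := by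
    intro x y
    have hr : 0 < φ y / φ x := div_pos (hφ y) (hφ x)
    have e := edge_ineq hα (hη x) (hη y) (hv x) (hv y) hr
    have hx := (hφ x).ne'
    have hy := (hφ y).ne'
    have e1 : η y ^ 2 * (φ y * u y) ^ (2 * α) + η x ^ 2 * (φ x * u x) ^ (2 * α)
        - φ y / φ x * (η y ^ 2 * ((φ y * u y) ^ (2 * α - 1) * (φ x * u x)))
        - (φ y / φ x)⁻¹ * (η x ^ 2 * ((φ x * u x) ^ (2 * α - 1) * (φ y * u y)))
        = (w y - w x) * (u y - u x) := by
      rw [hpow x, hpow y]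
      simp only [hw]
      field_simp
      ring
    have e2 : φ y / φ x + (φ y / φ x)⁻¹ - 2 = -((φ y - φ x) * ((φ y)⁻¹ - (φ x)⁻¹)) := by
      field_simp; ring
    rw [e1, e2] at e
    have := mul_le_mul_of_nonneg_left e (hc x y)
    rw [hs y x, hRs y x]
    refine this.trans (le_of_eq ?_)
    simp only [hR]; ring
  have hsum : ∑ x ∈ F, ∑ y ∈ F, c x y * ((w y - w x) * (u y - u x)) ≤ 0 := by
    rw [sum_by_parts F c hs]
    have : 0 ≤ ∑ x ∈ F, w x * ∑ y ∈ F, c x y * (u y - u x) := by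
      refine Finset.sum_nonneg fun x hx => ?_
      by_cases h : η x = 0
      · simp [hw, h]
      · exact mul_nonneg (hwn x) (hsub x hx h)
    linarith
  calc _ ≤ ∑ x ∈ F, ∑ y ∈ F, (4 * α * (c x y * ((w y - w x) * (u y - u x))) +
      40 * α ^ 2 * (c x y * (R x y * (φ x * u x) ^ (2 * α))) +
      40 * α ^ 2 * (c y x * (R y x * (φ y * u y) ^ (2 * α)))) :=
        Finset.sum_le_sum fun x _ => Finset.sum_le_sum fun y _ => key x y
    _ = 4 * α * ∑ x ∈ F, ∑ y ∈ F, c x y * ((w y - w x) * (u y - u x)) +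
      40 * α ^ 2 * ∑ x ∈ F, ∑ y ∈ F, c x y * (R x y * (φ x * u x) ^ (2 * α)) +
      40 * α ^ 2 * ∑ x ∈ F, ∑ y ∈ F, c x y * (R x y * (φ x * u x) ^ (2 * α)) := by
        simp only [Finset.sum_add_distrib, ← Finset.mul_sum]
        congr 2
        rw [Finset.sum_comm]
    _ ≤ _ := by
        have := mul_nonneg (by linarith : 0 ≤ 4 * α) (neg_nonneg.2 hsum)
        linarith

lemma abs_rpow_sub_le {a b s : ℝ} (ha : 0 ≤ a) (hb : 0 ≤ b) (hs : 1 ≤ s) :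
    |b ^ s - a ^ s| ≤ s * (a ^ (s - 1) + b ^ (s - 1)) * |b - a| := by
  have hs0 : 0 ≤ s := by linarith
  have pa := Real.rpow_nonneg ha (s - 1)
  have pb := Real.rpow_nonneg hb (s - 1)
  rcases le_total a b with h | h
  · rw [abs_of_nonneg (sub_nonneg.2 h),
      abs_of_nonneg (sub_nonneg.2 (Real.rpow_le_rpow ha h hs0))]
    refine (rpow_sub_le_bern ha h hs).trans ?_
    refine mul_le_mul_of_nonneg_right ?_ (sub_nonneg.2 h)
    exact mul_le_mul_of_nonneg_left (by linarith) hs0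
  · rw [abs_sub_comm, abs_sub_comm b a, abs_of_nonneg (sub_nonneg.2 h),
      abs_of_nonneg (sub_nonneg.2 (Real.rpow_le_rpow hb h hs0))]
    refine (rpow_sub_le_bern hb h hs).trans ?_
    refine mul_le_mul_of_nonneg_right ?_ (sub_nonneg.2 h)
    exact mul_le_mul_of_nonneg_left (by linarith) hs0

/-- The weighted `L²`-Sobolev inequality derived from the `L¹` one. -/
lemma sobolev_two {ι : Type*} (F B : Finset ι) (hBF : B ⊆ F) (c : ι → ι → ℝ)
    (hs : ∀ x y, c x y = c y x) (hc : ∀ x y, 0 ≤ c x y)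
    (f nu : ι → ℝ) (hf : ∀ x, 0 ≤ f x) (hfB : ∀ x, x ∉ B → f x = 0)
    (hnu : ∀ x ∈ B, ∑ y ∈ F, (if 0 < c x y then (c x y)⁻¹ else 0) ≤ nu x)
    {s r Qs N S νn : ℝ} (hs1 : 1 < s) (hr : 0 < r) (hQs : 0 < Qs) (hN : 0 < N) (hS : 0 ≤ S)
    (hsr : s * r = 2 * (s - 1) * Qs) (hpos : 0 < 2 / r - 1 / Qs) (hνn : 0 ≤ νn)
    (hν : ∀ k : ι → ℝ, (∀ x, 0 ≤ k x) → ∑ x ∈ B, nu x * k x ≤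
      N * νn * (N⁻¹ * ∑ x ∈ B, k x ^ Qs) ^ (1 / Qs))
    (hSob : (N⁻¹ * ∑ x ∈ B, (f x ^ s) ^ r) ^ (1 / r) ≤
      S * ∑ x ∈ F, ∑ y ∈ F, (if 0 < c x y then |f y ^ s - f x ^ s| else 0)) :
    (N⁻¹ * ∑ x ∈ B, f x ^ (s * r)) ^ (2 / r - 1 / Qs) ≤
      4 * s ^ 2 * S ^ 2 * N * νn * ∑ x ∈ F, ∑ y ∈ F, c x y * (f y - f x) ^ 2 := by
  set Y := N⁻¹ * ∑ x ∈ B, f x ^ (s * r) with hY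
  set En := ∑ x ∈ F, ∑ y ∈ F, c x y * (f y - f x) ^ 2 with hEn
  have hEn0 : 0 ≤ En := Finset.sum_nonneg fun x _ => Finset.sum_nonneg fun y _ =>
    mul_nonneg (hc x y) (sq_nonneg _)
  have hY0 : 0 ≤ Y := mul_nonneg (inv_nonneg.2 hN.le)
    (Finset.sum_nonneg fun x _ => Real.rpow_nonneg (hf x) _)
  have hs0 : 0 < s - 1 := by linarith
  have e1 : N⁻¹ * ∑ x ∈ B, (f x ^ s) ^ r = Y := by
    rw [hY]; congr 1
    exact Finset.sum_congr rfl fun x _ => by rw [← Real.rpow_mul (hf x)]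
  rw [e1] at hSob
  -- inverse conductances
  set ci : ι → ι → ℝ := fun x y => if 0 < c x y then (c x y)⁻¹ else 0 with hci
  have hci0 : ∀ x y, 0 ≤ ci x y := fun x y => by
    simp only [hci]; split_ifs with h
    · exact inv_nonneg.2 h.le
    · exact le_rfl
  have hcis : ∀ x y, ci x y = ci y x := fun x y => by simp only [hci, hs x y]
  set g : ι → ℝ := fun x => f x ^ (s - 1) with hg
  have hg0 : ∀ x, 0 ≤ g x := fun x => Real.rpow_nonneg (hf x) _
  have hgB : ∀ x, x ∉ B → g x = 0 := fun x hx => by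
    simp only [hg, hfB x hx]; exact Real.zero_rpow hs0.ne'
  set J := ∑ x ∈ F, ∑ y ∈ F, ci x y * (g x + g y) ^ 2 with hJ
  have hJ0 : 0 ≤ J := Finset.sum_nonneg fun x _ => Finset.sum_nonneg fun y _ =>
    mul_nonneg (hci0 x y) (sq_nonneg _)
  have hgrad : (∑ x ∈ F, ∑ y ∈ F, (if 0 < c x y then |f y ^ s - f x ^ s| else 0)) ≤
      s * (√En * √J) := by
    have step : ∀ x y, (if 0 < c x y then |f y ^ s - f x ^ s| else 0) ≤
        s * ((√(c x y) * |f y - f x|) * (√(ci x y) * (g x + g y))) := by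
      intro x y
      split_ifs with h
      · have : √(c x y) * √(ci x y) = 1 := by
          rw [← Real.sqrt_mul (hc x y)]
          simp only [hci, h, if_true]
          rw [mul_inv_cancel₀ h.ne', Real.sqrt_one]
        calc _ ≤ _ := abs_rpow_sub_le (hf x) (hf y) hs1.le
          _ = s * (g x + g y) * |f y - f x| * (√(c x y) * √(ci x y)) := by rw [this, mul_one]
          _ = _ := by ring
      · have := hg0 x
        have := hg0 y
        positivity
    refine (Finset.sum_le_sum fun x _ => Finset.sum_le_sum fun y _ => step x y).trans ?_
    simp only [← Finset.mul_sum]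
    refine mul_le_mul_of_nonneg_left ?_ (by linarith)
    rw [← Finset.sum_product', hEn, hJ, ← Finset.sum_product', ← Finset.sum_product']
    refine (Real.sum_mul_le_sqrt_mul_sqrt _ _ _).trans (le_of_eq ?_)
    congr 2
    · refine Finset.sum_congr rfl fun z _ => ?_
      rw [mul_pow, Real.sq_sqrt (hc _ _), sq_abs]
    · refine Finset.sum_congr rfl fun z _ => ?_
      rw [mul_pow, Real.sq_sqrt (hci0 _ _)]
  have hJle : J ≤ 4 * (N * νn * Y ^ (1 / Qs)) := by
    have a1 : J ≤ ∑ x ∈ F, ∑ y ∈ F, (2 * (ci x y * g x ^ 2) + 2 * (ci y x * g y ^ 2)) := by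
      refine Finset.sum_le_sum fun x _ => Finset.sum_le_sum fun y _ => ?_
      rw [hcis y x]
      have := mul_le_mul_of_nonneg_left (add_sq_le (a := g x) (b := g y)) (hci0 x y)
      linarith
    have a2 : ∑ x ∈ F, ∑ y ∈ F, (2 * (ci x y * g x ^ 2) + 2 * (ci y x * g y ^ 2)) =
        4 * ∑ x ∈ F, ∑ y ∈ F, ci x y * g x ^ 2 := by
      simp only [Finset.sum_add_distrib, ← Finset.mul_sum]
      rw [Finset.sum_comm (f := fun x y => ci y x * g y ^ 2)]
      ring
    have a3 : ∑ x ∈ F, ∑ y ∈ F, ci x y * g x ^ 2 = ∑ x ∈ B, (∑ y ∈ F, ci x y) * g x ^ 2 := by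
      rw [← Finset.sum_subset hBF]
      · exact Finset.sum_congr rfl fun x _ => by rw [Finset.sum_mul]
      · intro x _ hx
        exact Finset.sum_eq_zero fun y _ => by rw [hgB x hx]; ring
    have a4 : ∑ x ∈ B, (∑ y ∈ F, ci x y) * g x ^ 2 ≤ ∑ x ∈ B, nu x * g x ^ 2 :=
      Finset.sum_le_sum fun x hx => mul_le_mul_of_nonneg_right (hnu x hx) (sq_nonneg _)
    have a5 := hν (fun x => g x ^ 2) fun x => sq_nonneg _
    have a6 : N⁻¹ * ∑ x ∈ B, (g x ^ 2) ^ Qs = Y := by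
      rw [hY]; congr 1
      refine Finset.sum_congr rfl fun x _ => ?_
      simp only [hg]
      rw [← Real.rpow_natCast, ← Real.rpow_mul (hf x), ← Real.rpow_mul (hf x), hsr]
      congr 1; push_cast; ring
    rw [a6] at a5
    linarith
  rcases eq_or_lt_of_le hY0 with h0 | hYp
  · rw [← h0, Real.zero_rpow hpos.ne']
    positivity
  have hA : Y ^ (1 / r) ≤ S * (s * (√En * √J)) :=
    hSob.trans (mul_le_mul_of_nonneg_left hgrad hS)
  have hB : Y ^ (2 / r) ≤ S ^ 2 * s ^ 2 * En * J := by
    have : Y ^ (2 / r) = (Y ^ (1 / r)) ^ 2 := by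
      rw [← Real.rpow_natCast, ← Real.rpow_mul hY0]; congr 1; push_cast; ring
    rw [this]
    calc _ ≤ (S * (s * (√En * √J))) ^ 2 := pow_le_pow_left₀ (Real.rpow_nonneg hY0 _) hA 2
      _ = S ^ 2 * s ^ 2 * (√En ^ 2) * (√J ^ 2) := by ring
      _ = _ := by rw [Real.sq_sqrt hEn0, Real.sq_sqrt hJ0]
  rw [Real.rpow_sub hYp, div_le_iff₀ (Real.rpow_pos_of_pos hYp _)]
  refine hB.trans ?_
  have : S ^ 2 * s ^ 2 * En * J ≤ S ^ 2 * s ^ 2 * En * (4 * (N * νn * Y ^ (1 / Qs))) :=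
    mul_le_mul_of_nonneg_left hJle (by positivity)
  refine this.trans (le_of_eq ?_)
  ring

/-- One step of the Moser iteration on a finite weighted graph (large gap). -/
lemma moser_step {ι : Type*} (F B Bs Bs' : Finset ι) (hBF : B ⊆ F) (hBsB : Bs ⊆ B)
    (hBs' : Bs' ⊆ Bs) (c : ι → ι → ℝ) (hs : ∀ x y, c x y = c y x) (hc : ∀ x y, 0 ≤ c x y)
    (u φ η nu mu ga : ι → ℝ) (hu : ∀ x, 0 ≤ u x) (hφ : ∀ x, 0 < φ x)
    (hη : ∀ x, 0 ≤ η x) (hη1 : ∀ x, η x ≤ 1) (hηs : ∀ x ∈ Bs', η x = 1)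
    (hη0 : ∀ x, x ∉ Bs → η x = 0)
    (hηc : ∀ x y, c x y ≠ 0 → η x ≠ 0 → y ∈ Bs)
    {w2 : ℝ} (hw2 : 0 ≤ w2) (hηg : ∀ x y, c x y ≠ 0 → (η y - η x) ^ 2 ≤ w2)
    (hsub : ∀ x ∈ B, 0 ≤ ∑ y ∈ F, c x y * (u y - u x))
    (hnu : ∀ x ∈ B, ∑ y ∈ F, (if 0 < c x y then (c x y)⁻¹ else 0) ≤ nu x)
    (hmu : ∀ x ∈ B, ∑ y ∈ F, c x y ≤ mu x)
    (hga : ∀ x ∈ B, ∑ y ∈ F, c x y * (-((φ y - φ x) * ((φ y)⁻¹ - (φ x)⁻¹))) ≤ ga x)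
    {s r Qs P N S νn μn Γn α ρ : ℝ} (hs1 : 1 < s) (hr : 0 < r) (hQs : 0 < Qs) (hP : 0 < P)
    (hN : 0 < N) (hS : 0 ≤ S)
    (hsr : s * r = 2 * (s - 1) * Qs) (hpos : 0 < 1 / ρ) (hρ1 : 2 / r - 1 / Qs = 1 / ρ)
    (hρ2 : s * r = 2 * ρ)
    (hνn : 0 ≤ νn) (hα : 1 ≤ α)
    (hν : ∀ k : ι → ℝ, (∀ x, 0 ≤ k x) → ∑ x ∈ B, nu x * k x ≤
      N * νn * (N⁻¹ * ∑ x ∈ B, k x ^ Qs) ^ (1 / Qs))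
    (hμ : ∀ k : ι → ℝ, (∀ x, 0 ≤ k x) → ∑ x ∈ B, mu x * k x ≤
      N * μn * (N⁻¹ * ∑ x ∈ B, k x ^ P) ^ (1 / P))
    (hΓ : ∀ k : ι → ℝ, (∀ x, 0 ≤ k x) → ∑ x ∈ B, ga x * k x ≤
      N * Γn * (N⁻¹ * ∑ x ∈ B, k x ^ P) ^ (1 / P))
    (hSob : ∀ g : ι → ℝ, (∀ x, 0 ≤ g x) → (∀ x, x ∉ B → g x = 0) →
      (N⁻¹ * ∑ x ∈ B, g x ^ r) ^ (1 / r) ≤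
      S * ∑ x ∈ F, ∑ y ∈ F, (if 0 < c x y then |g y - g x| else 0)) :
    (N⁻¹ * ∑ x ∈ Bs', (φ x * u x) ^ (2 * α * ρ)) ^ (1 / ρ) ≤
      320 * s ^ 2 * (S * N) ^ 2 * νn * α ^ 2 * (w2 * μn + 2 * Γn) *
        (N⁻¹ * ∑ x ∈ Bs, (φ x * u x) ^ (2 * α * P)) ^ (1 / P) := by
  have hv : ∀ x, 0 ≤ φ x * u x := fun x => mul_nonneg (hφ x).le (hu x)
  set f : ι → ℝ := fun x => η x * (φ x * u x) ^ α with hf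
  have hf0 : ∀ x, 0 ≤ f x := fun x => mul_nonneg (hη x) (Real.rpow_nonneg (hv x) _)
  have hfB : ∀ x, x ∉ B → f x = 0 := fun x hx => by
    simp only [hf, hη0 x fun h => hx (hBsB h), zero_mul]
  set Yv := (N⁻¹ * ∑ x ∈ Bs, (φ x * u x) ^ (2 * α * P)) ^ (1 / P) with hYv
  -- energy bound
  have hEn : ∑ x ∈ F, ∑ y ∈ F, c x y * (f y - f x) ^ 2 ≤
      80 * α ^ 2 * (N * (w2 * μn + 2 * Γn) * Yv) := by
    have h1 := cacc F c hs hc u φ η hu hφ hη (fun x _ hx => hsub x (by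
      by_contra h; exact hx (hη0 x fun h' => h (hBsB h')))) hα
    refine h1.trans (mul_le_mul_of_nonneg_left ?_ (by positivity))
    set k : ι → ℝ := fun x => if x ∈ Bs then (φ x * u x) ^ (2 * α) else 0 with hk
    have hk0 : ∀ x, 0 ≤ k x := fun x => by
      simp only [hk]; split_ifs
      · exact Real.rpow_nonneg (hv x) _
      · exact le_rfl
    have hkY : (N⁻¹ * ∑ x ∈ B, k x ^ P) ^ (1 / P) = Yv := by
      rw [hYv]; congr 2
      rw [← Finset.sum_subset hBsB]
      · refine Finset.sum_congr rfl fun x hx => ?_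
        simp only [hk, hx, if_true]
        rw [← Real.rpow_mul (hv x)]
      · intro x _ hx
        simp only [hk, hx, if_false]
        exact Real.zero_rpow hP.ne'
    have hDn : ∀ x y, 0 ≤ -((φ y - φ x) * ((φ y)⁻¹ - (φ x)⁻¹)) := fun x y => by
      have hx := hφ x
      have hy := hφ y
      have : -((φ y - φ x) * ((φ y)⁻¹ - (φ x)⁻¹)) = (φ y - φ x) ^ 2 * ((φ y)⁻¹ * (φ x)⁻¹) := by
        field_simp; ring
      rw [this]; positivity
    have point : ∀ x ∈ F, ∑ y ∈ F, c x y * (((η y - η x) ^ 2 +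
        (η x ^ 2 + η y ^ 2) * (-((φ y - φ x) * ((φ y)⁻¹ - (φ x)⁻¹)))) *
          (φ x * u x) ^ (2 * α)) ≤ if x ∈ B then w2 * (mu x * k x) + 2 * (ga x * k x) else 0 := by
      intro x _
      by_cases hx : x ∈ Bs
      · rw [if_pos (hBsB hx)]
        have hkx : k x = (φ x * u x) ^ (2 * α) := by simp only [hk, hx, if_true]
        rw [← hkx]
        calc _ ≤ ∑ y ∈ F, (w2 * k x * c x y +
              2 * k x * (c x y * (-((φ y - φ x) * ((φ y)⁻¹ - (φ x)⁻¹))))) := by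
              refine Finset.sum_le_sum fun y _ => ?_
              by_cases hxy : c x y = 0
              · simp [hxy]
              · have g1 := hηg x y hxy
                have g2 : η x ^ 2 + η y ^ 2 ≤ 2 := by
                  have := hη x; have := hη y; have := hη1 x; have := hη1 y; nlinarith
                have g3 := mul_le_mul_of_nonneg_right g2 (hDn x y)
                have g4 := mul_le_mul_of_nonneg_left
                  (mul_le_mul_of_nonneg_right (add_le_add g1 g3) (hk0 x)) (hc x y)
                refine g4.trans (le_of_eq ?_)
                ring
          _ = w2 * k x * ∑ y ∈ F, c x y + 2 * k x * ∑ y ∈ F,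
                c x y * (-((φ y - φ x) * ((φ y)⁻¹ - (φ x)⁻¹))) := by
              rw [Finset.sum_add_distrib, Finset.mul_sum, Finset.mul_sum]
          _ ≤ w2 * k x * mu x + 2 * k x * ga x := by
              refine add_le_add (mul_le_mul_of_nonneg_left (hmu x (hBsB hx)) ?_)
                (mul_le_mul_of_nonneg_left (hga x (hBsB hx)) ?_)
              · exact mul_nonneg hw2 (hk0 x)
              · exact mul_nonneg zero_le_two (hk0 x)
          _ = _ := by ring
      · have hkx : k x = 0 := by simp only [hk, hx, if_false]
        have : ∑ y ∈ F, c x y * (((η y - η x) ^ 2 +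
          (η x ^ 2 + η y ^ 2) * (-((φ y - φ x) * ((φ y)⁻¹ - (φ x)⁻¹)))) *
            (φ x * u x) ^ (2 * α)) = 0 := by
          refine Finset.sum_eq_zero fun y _ => ?_
          by_cases hxy : c x y = 0
          · simp [hxy]
          · have e1 : η x = 0 := hη0 x hx
            have e2 : η y = 0 := by
              by_contra h
              exact hx (hηc y x (by rwa [hs y x]) h)
            rw [e1, e2]; ring
        rw [this, hkx]; simp
    refine (Finset.sum_le_sum point).trans ?_
    rw [← Finset.sum_filter, Finset.filter_mem_eq_inter, Finset.inter_eq_right.2 hBF,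
      Finset.sum_add_distrib, ← Finset.mul_sum, ← Finset.mul_sum]
    have m1 := hμ k hk0
    have m2 := hΓ k hk0
    rw [hkY] at m1 m2
    have m3 := mul_le_mul_of_nonneg_left m1 hw2
    linarith
  have hsob := sobolev_two F B hBF c hs hc f nu hf0 hfB hnu hs1 hr hQs hN hS hsr
    (by rw [hρ1]; exact hpos) hνn hν (hSob (fun x => f x ^ s) (fun x => Real.rpow_nonneg (hf0 x) _)
      fun x hx => by simp only [hfB x hx]; exact Real.zero_rpow (by linarith))
  rw [hρ1, hρ2] at hsob
  have hlow : N⁻¹ * ∑ x ∈ Bs', (φ x * u x) ^ (2 * α * ρ) ≤ N⁻¹ * ∑ x ∈ B, f x ^ (2 * ρ) := by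
    refine mul_le_mul_of_nonneg_left ?_ (inv_nonneg.2 hN.le)
    refine le_trans (le_of_eq ?_) (Finset.sum_le_sum_of_subset_of_nonneg (hBs'.trans hBsB)
      fun x _ _ => Real.rpow_nonneg (hf0 x) _)
    refine Finset.sum_congr rfl fun x hx => ?_
    simp only [hf, hηs x hx, one_mul]
    rw [← Real.rpow_mul (hv x)]; congr 1; ring
  have hlow0 : 0 ≤ N⁻¹ * ∑ x ∈ Bs', (φ x * u x) ^ (2 * α * ρ) :=
    mul_nonneg (inv_nonneg.2 hN.le) (Finset.sum_nonneg fun x _ => Real.rpow_nonneg (hv x) _)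
  refine (Real.rpow_le_rpow hlow0 hlow hpos.le).trans (hsob.trans ?_)
  have := mul_le_mul_of_nonneg_left hEn
    (by positivity : 0 ≤ 4 * s ^ 2 * S ^ 2 * N * νn)
  refine this.trans (le_of_eq ?_)
  ring

/-- `∑ z^θ ≤ (∑ z)^θ`. -/
lemma sum_rpow_le {ι : Type*} (B : Finset ι) (z : ι → ℝ) (hz : ∀ x, 0 ≤ z x) {θ : ℝ}
    (hθ : 1 ≤ θ) : ∑ x ∈ B, z x ^ θ ≤ (∑ x ∈ B, z x) ^ θ := by
  have h0 : 0 ≤ ∑ x ∈ B, z x := Finset.sum_nonneg fun x _ => hz x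
  have split : ∀ t : ℝ, 0 ≤ t → t ^ θ = t * t ^ (θ - 1) := fun t ht => by
    conv_rhs => lhs; rw [← Real.rpow_one t]
    rw [← Real.rpow_add_of_nonneg ht zero_le_one (by linarith)]; ring_nf
  rw [split _ h0, Finset.sum_mul]
  refine Finset.sum_le_sum fun x hx => ?_
  rw [split _ (hz x)]
  exact mul_le_mul_of_nonneg_left (Real.rpow_le_rpow (hz x)
    (Finset.single_le_sum (fun y _ => hz y) hx) (by linarith)) (hz x)

/-- One step of the iteration for a small gap (trivial bound). -/
lemma trivial_step {ι : Type*} (Bs Bs' : Finset ι) (hB : Bs' ⊆ Bs) (v : ι → ℝ)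
    (hv : ∀ x, 0 ≤ v x) {N P ρ α : ℝ} (hN : 0 < N) (hP : 0 < P) (hρ : P ≤ ρ) :
    (N⁻¹ * ∑ x ∈ Bs', v x ^ (2 * α * ρ)) ^ (1 / ρ) ≤
      N ^ (1 / P - 1 / ρ) * (N⁻¹ * ∑ x ∈ Bs, v x ^ (2 * α * P)) ^ (1 / P) := by
  have hρ0 : 0 < ρ := hP.trans_le hρ
  have hz : ∀ x, 0 ≤ v x ^ (2 * α * P) := fun x => Real.rpow_nonneg (hv x) _
  have h0 : 0 ≤ ∑ x ∈ Bs, v x ^ (2 * α * P) := Finset.sum_nonneg fun x _ => hz x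
  have h1 : ∑ x ∈ Bs', v x ^ (2 * α * ρ) ≤ (∑ x ∈ Bs, v x ^ (2 * α * P)) ^ (ρ / P) := by
    refine le_trans ?_ (sum_rpow_le Bs _ hz ((one_le_div hP).2 hρ))
    refine le_trans (Finset.sum_le_sum_of_subset_of_nonneg hB
      fun x _ _ => Real.rpow_nonneg (hv x) _) (le_of_eq ?_)
    refine Finset.sum_congr rfl fun x _ => ?_
    rw [← Real.rpow_mul (hv x)]; congr 1; field_simp
  calc _ ≤ (N⁻¹ * (∑ x ∈ Bs, v x ^ (2 * α * P)) ^ (ρ / P)) ^ (1 / ρ) := by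
        refine Real.rpow_le_rpow ?_ (mul_le_mul_of_nonneg_left h1 (by positivity)) (by positivity)
        exact mul_nonneg (by positivity) (Finset.sum_nonneg fun x _ => Real.rpow_nonneg (hv x) _)
    _ = _ := by
        rw [Real.mul_rpow (by positivity) (Real.rpow_nonneg h0 _),
          Real.mul_rpow (by positivity) h0, ← Real.rpow_mul h0, Real.rpow_sub hN,
          Real.inv_rpow hN.le, Real.inv_rpow hN.le]
        have : ρ / P * (1 / ρ) = 1 / P := by field_simp
        rw [this]
        have := (Real.rpow_pos_of_pos hN (1 / P)).ne'
        have := (Real.rpow_pos_of_pos hN (1 / ρ)).ne'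
        field_simp

lemma summable_geo {θ : ℝ} (hθ : 1 < θ) : Summable fun j : ℕ => 1 / (2 * θ ^ j) := by
  have := (summable_geometric_of_lt_one (by positivity) (inv_lt_one_of_one_lt₀ hθ)).mul_left (1 / 2)
  refine this.congr fun j => ?_
  rw [inv_pow]; field_simp

lemma summable_geo' {θ : ℝ} (hθ : 1 < θ) : Summable fun j : ℕ => (j : ℝ) * (1 / (2 * θ ^ j)) := by
  have h := (summable_pow_mul_geometric_of_norm_lt_one (R := ℝ) 1 (r := θ⁻¹) (by
    rw [Real.norm_of_nonneg (by positivity)]; exact inv_lt_one_of_one_lt₀ hθ)).mul_left (1 / 2)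
  refine h.congr fun j => ?_
  rw [inv_pow]; field_simp

/-- The iteration. -/
lemma moser_iter {ι : Type*} (Bs : ℝ → Finset ι) (hB : ∀ σ' σ, σ' ≤ σ → Bs σ' ⊆ Bs σ)
    (v : ι → ℝ) (hv : ∀ x, 0 ≤ v x) {N P ρ C M : ℝ} (hN : 0 < N) (hP : 1 ≤ P) (hρ : P < ρ)
    (hC : 1 ≤ C) (hM : 1 ≤ M)
    (hstep : ∀ σ' σ α : ℝ, 1 / 2 ≤ σ' → σ' < σ → σ ≤ 1 → 1 ≤ α →
      (N⁻¹ * ∑ x ∈ Bs σ', v x ^ (2 * α * ρ)) ^ (1 / ρ) ≤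
        C * α ^ 2 * (M / (σ - σ') ^ 2) * (N⁻¹ * ∑ x ∈ Bs σ, v x ^ (2 * α * P)) ^ (1 / P))
    (σ' σ : ℝ) (h1 : 1 / 2 ≤ σ') (h2 : σ' < σ) (h3 : σ ≤ 1) (x : ι) (hx : x ∈ Bs σ') :
    v x ≤ (4 * C * (M / (σ - σ') ^ 2)) ^ (∑' j : ℕ, 1 / (2 * (ρ / P) ^ j)) *
      (4 * (ρ / P) ^ 2) ^ (∑' j : ℕ, (j : ℝ) * (1 / (2 * (ρ / P) ^ j))) *
      (N⁻¹ * ∑ x ∈ Bs σ, v x ^ (2 * P)) ^ (1 / (2 * P)) := by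
  have hP0 : 0 < P := by linarith
  have hρ0 : 0 < ρ := by linarith
  obtain ⟨θ, hθd⟩ : ∃ θ, θ = ρ / P := ⟨_, rfl⟩
  rw [← hθd]
  have hθ : 1 < θ := by rw [hθd]; exact (one_lt_div hP0).2 hρ
  have hθ0 : 0 < θ := by linarith
  have hρθ : ρ = P * θ := by rw [hθd]; field_simp
  set K := 4 * C * (M / (σ - σ') ^ 2) with hK
  have hδ : 0 < σ - σ' := by linarith
  have hMd : 1 ≤ M / (σ - σ') ^ 2 := by
    rw [one_le_div (by positivity)]; nlinarith
  have hK1 : 1 ≤ K := by rw [hK]; nlinarith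
  have hb1 : 1 ≤ 4 * θ ^ 2 := by nlinarith
  set b := 4 * θ ^ 2 with hb
  set sg : ℕ → ℝ := fun k => σ' + (σ - σ') * (1 / 2) ^ k with hsg
  set T : ℕ → ℝ := fun k =>
    (N⁻¹ * ∑ x ∈ Bs (sg k), v x ^ (2 * P * θ ^ k)) ^ (1 / (2 * P * θ ^ k)) with hT
  have hA0 : ∀ (s t : ℝ), 0 ≤ N⁻¹ * ∑ x ∈ Bs s, v x ^ t := fun s t =>
    mul_nonneg (inv_nonneg.2 hN.le) (Finset.sum_nonneg fun x _ => Real.rpow_nonneg (hv x) _)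
  have hT0 : ∀ k, 0 ≤ T k := fun k => Real.rpow_nonneg (hA0 _ _) _
  have hTs : ∀ k, T (k + 1) ≤ (K * b ^ k) ^ (1 / (2 * θ ^ k)) * T k := by
    intro k
    have hθk : 1 ≤ θ ^ k := one_le_pow₀ hθ.le
    have hpk : (0:ℝ) < (1 / 2) ^ k := by positivity
    have hpk1 : ((1:ℝ) / 2) ^ k ≤ 1 := pow_le_one₀ (by norm_num) (by norm_num)
    have hlt : sg (k + 1) < sg k := by
      simp only [hsg, pow_succ]; nlinarith
    have hge : 1 / 2 ≤ sg (k + 1) := by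
      simp only [hsg]
      have : 0 ≤ (σ - σ') * (1 / 2) ^ (k + 1) := by positivity
      linarith
    have hle : sg k ≤ 1 := by
      simp only [hsg]; nlinarith
    have h := hstep (sg (k + 1)) (sg k) (θ ^ k) hge hlt hle hθk
    have hgap : C * (θ ^ k) ^ 2 * (M / (sg k - sg (k + 1)) ^ 2) = K * b ^ k := by
      have : sg k - sg (k + 1) = (σ - σ') * ((1 / 2) ^ k * (1 / 2)) := by
        simp only [hsg, pow_succ]; ring
      rw [this, hK, hb, mul_pow 4, ← pow_mul, ← pow_mul, mul_comm k 2]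
      have e4 : (4:ℝ) ^ k = ((1 / 2) ^ k * (1 / 2) ^ k)⁻¹ := by
        rw [← mul_pow, ← inv_pow]; norm_num
      rw [e4]
      field_simp
      ring
    rw [hgap] at h
    have hexp : 0 ≤ 1 / (2 * θ ^ k) := by positivity
    have h' := Real.rpow_le_rpow (Real.rpow_nonneg (hA0 _ _) _) h hexp
    rw [Real.mul_rpow (by positivity) (Real.rpow_nonneg (hA0 _ _) _),
      ← Real.rpow_mul (hA0 _ _), ← Real.rpow_mul (hA0 _ _)] at h'
    simp only [hT]
    have x1 : 2 * P * θ ^ (k + 1) = 2 * θ ^ k * ρ := by rw [hρθ]; ring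
    have x2 : 2 * P * θ ^ k = 2 * θ ^ k * P := by ring
    rw [x1, x2]
    have x3 : 1 / (2 * θ ^ k * ρ) = 1 / ρ * (1 / (2 * θ ^ k)) := by field_simp
    have x4 : 1 / (2 * θ ^ k * P) = 1 / P * (1 / (2 * θ ^ k)) := by field_simp
    rw [x3, x4]
    exact h'
  have hK0 : 0 < K := by linarith
  have hb0 : 0 < b := by linarith
  have hind : ∀ k, T k ≤ K ^ (∑ j ∈ Finset.range k, 1 / (2 * θ ^ j)) *
      b ^ (∑ j ∈ Finset.range k, (j : ℝ) * (1 / (2 * θ ^ j))) * T 0 := by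
    intro k
    induction k with
    | zero => simp
    | succ k ih =>
      refine (hTs k).trans ?_
      refine (mul_le_mul_of_nonneg_left ih (by positivity)).trans (le_of_eq ?_)
      rw [Finset.sum_range_succ, Finset.sum_range_succ, Real.rpow_add hK0, Real.rpow_add hb0,
        Real.mul_rpow hK0.le (by positivity)]
      have : (b ^ k) ^ (1 / (2 * θ ^ k)) = b ^ ((k : ℝ) * (1 / (2 * θ ^ k))) := by
        rw [Real.rpow_mul hb0.le, Real.rpow_natCast]
      rw [this]; ring
  set Z := K ^ (∑' j : ℕ, 1 / (2 * θ ^ j)) * b ^ (∑' j : ℕ, (j : ℝ) * (1 / (2 * θ ^ j))) * T 0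
    with hZ
  have hTZ : ∀ k, T k ≤ Z := by
    intro k
    refine (hind k).trans ?_
    refine mul_le_mul_of_nonneg_right ?_ (hT0 0)
    refine mul_le_mul ?_ ?_ (by positivity) (by positivity)
    · exact Real.rpow_le_rpow_of_exponent_le hK1
        ((summable_geo hθ).sum_le_tsum _ fun j _ => by positivity)
    · exact Real.rpow_le_rpow_of_exponent_le hb1
        ((summable_geo' hθ).sum_le_tsum _ fun j _ => by positivity)
  have hsup : ∀ k, v x ≤ N ^ (1 / (2 * P * θ ^ k)) * Z := by
    intro k
    have ht : 0 < 2 * P * θ ^ k := by positivity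
    have hxk : x ∈ Bs (sg k) := hB σ' _ (by
      simp only [hsg]
      have : 0 ≤ (σ - σ') * (1 / 2) ^ k := by positivity
      linarith) hx
    have a1 : v x ^ (2 * P * θ ^ k) ≤ N * (N⁻¹ * ∑ x ∈ Bs (sg k), v x ^ (2 * P * θ ^ k)) := by
      rw [← mul_assoc, mul_inv_cancel₀ hN.ne', one_mul]
      exact Finset.single_le_sum (f := fun x => v x ^ (2 * P * θ ^ k))
        (fun y _ => Real.rpow_nonneg (hv y) _) hxk
    have a2 := Real.rpow_le_rpow (Real.rpow_nonneg (hv x) _) a1 (by positivity :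
      0 ≤ 1 / (2 * P * θ ^ k))
    rw [← Real.rpow_mul (hv x), mul_one_div_cancel ht.ne', Real.rpow_one,
      Real.mul_rpow hN.le (hA0 _ _)] at a2
    exact a2.trans (mul_le_mul_of_nonneg_left (hTZ k) (by positivity))
  have hlim : Tendsto (fun k : ℕ => N ^ (1 / (2 * P * θ ^ k)) * Z) atTop (𝓝 (N ^ (0:ℝ) * Z)) := by
    refine Tendsto.mul_const _ ?_
    refine Tendsto.rpow tendsto_const_nhds ?_ (Or.inl hN.ne')
    refine Tendsto.div_atTop tendsto_const_nhds ?_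
    exact Tendsto.const_mul_atTop (by positivity) (tendsto_pow_atTop_atTop_of_one_lt hθ)
  have := ge_of_tendsto' hlim hsup
  rw [Real.rpow_zero, one_mul, hZ] at this
  have e0 : T 0 = (N⁻¹ * ∑ x ∈ Bs σ, v x ^ (2 * P)) ^ (1 / (2 * P)) := by
    simp [hT, hsg]
  rw [e0] at this
  exact this

lemma adj_iff_nbrs {d : ℕ} (x y : Vert d) : adj x y ↔ y ∈ nbrs x := by
  unfold adj nbrs
  constructor
  · intro h
    have hex : ∃ i, (x i - y i).natAbs = 1 ∧
        ∀ j ∈ (Finset.univ : Finset (Fin d)), j ≠ i → (x j - y j).natAbs = 0 := by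
      have h0 : (∑ i, (x i - y i).natAbs) ≠ 0 := by omega
      obtain ⟨i, -, hi⟩ := Finset.exists_ne_zero_of_sum_ne_zero h0
      have h1 := Finset.add_sum_erase Finset.univ (fun i => (x i - y i).natAbs)
        (Finset.mem_univ i)
      rw [h] at h1
      refine ⟨i, by omega, ?_⟩
      intro j hj hji
      have h2 : (∑ i ∈ Finset.univ.erase i, (x i - y i).natAbs) = 0 := by omega
      exact (Finset.sum_eq_zero_iff.1 h2) j (Finset.mem_erase.2 ⟨hji, hj⟩)
    obtain ⟨i, hi, hj⟩ := hex
    simp only [Finset.mem_image, Finset.mem_univ, true_and, Prod.exists]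
    refine ⟨i, decide (x i < y i), ?_⟩
    funext j
    by_cases hji : j = i
    · subst hji
      simp only [Function.update_self]
      by_cases hlt : x j < y j
      · simp only [hlt, decide_true, if_true]; omega
      · simp only [hlt, decide_false]; simp only [Bool.false_eq_true, if_false]; omega
    · rw [Function.update_of_ne hji]
      have := hj j (Finset.mem_univ _) hji
      omega
  · intro h
    simp only [Finset.mem_image, Finset.mem_univ, true_and, Prod.exists] at h
    obtain ⟨i, b, rfl⟩ := h
    rw [Finset.sum_eq_single i]
    · simp only [Function.update_self]
      cases b <;> simp
    · intro j _ hji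
      rw [Function.update_of_ne hji]; simp
    · simp

lemma adj_symm' {d : ℕ} {x y : Vert d} (h : adj x y) : adj y x := by
  unfold adj at *
  rw [← h]
  apply Finset.sum_congr rfl
  intro i _
  omega

lemma mem_ball_iff {d : ℕ} (a : Vert d → Vert d → ℝ) (x y : Vert d) {r : ℝ} (hr : 0 ≤ r) :
    y ∈ ballCh a x r ↔ ∃ p, IsOpenPath a x y p ∧ p.length - 1 ≤ ⌊r⌋₊ := by
  unfold ballCh chemDist
  simp only [Set.mem_ofPred_eq]
  constructor
  · intro h
    have h1 : ENNReal.ofReal r < ((⌊r⌋₊ + 1 : ℕ) : ℝ≥0∞) := by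
      rw [← ENNReal.ofReal_natCast]
      apply (ENNReal.ofReal_lt_ofReal_iff (by positivity)).2
      push_cast
      exact Nat.lt_floor_add_one r
    have h2 := lt_of_le_of_lt h h1
    rw [iInf_lt_iff] at h2
    obtain ⟨⟨p, hp⟩, h3⟩ := h2
    refine ⟨p, hp, ?_⟩
    have h4 : p.length - 1 < ⌊r⌋₊ + 1 := by exact_mod_cast h3
    omega
  · rintro ⟨p, hp, hl⟩
    refine (iInf_le _ (⟨p, hp⟩ : {p // IsOpenPath a x y p})).trans ?_
    rw [← ENNReal.ofReal_natCast]
    apply ENNReal.ofReal_le_ofReal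
    exact (Nat.cast_le.2 hl).trans (Nat.floor_le hr)

lemma ball_floor {d : ℕ} (a : Vert d → Vert d → ℝ) (x : Vert d) {r : ℝ} (hr : 0 ≤ r) :
    ballCh a x r = ballCh a x (⌊r⌋₊ : ℝ) := by
  ext y
  rw [mem_ball_iff a x y hr, mem_ball_iff a x y (Nat.cast_nonneg _), Nat.floor_natCast]

lemma self_mem_ball {d : ℕ} (a : Vert d → Vert d → ℝ) (x : Vert d) {r : ℝ} (hr : 0 ≤ r) :
    x ∈ ballCh a x r := by
  rw [mem_ball_iff a x x hr]
  refine ⟨[x], ⟨by simp, by simp, ?_⟩, by simp⟩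
  simp [List.Chain']

lemma ball_mono {d : ℕ} (a : Vert d → Vert d → ℝ) (x : Vert d) {r s : ℝ} (h : r ≤ s) :
    ballCh a x r ⊆ ballCh a x s := by
  intro y hy
  exact le_trans hy (ENNReal.ofReal_le_ofReal h)

lemma ball_succ {d : ℕ} (a : Vert d → Vert d → ℝ) (x : Vert d) {k : ℕ} {y z : Vert d}
    (hy : y ∈ ballCh a x (k : ℝ)) (hyz : openAdj a y z) :
    z ∈ ballCh a x ((k + 1 : ℕ) : ℝ) := by
  rw [mem_ball_iff a x y (Nat.cast_nonneg _), Nat.floor_natCast] at hy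
  rw [mem_ball_iff a x z (Nat.cast_nonneg _), Nat.floor_natCast]
  obtain ⟨p, ⟨h1, h2, h3⟩, h4⟩ := hy
  refine ⟨p ++ [z], ⟨?_, by simp, ?_⟩, ?_⟩
  · cases p with
    | nil => simp at h1
    | cons b l => simpa using h1
  · unfold List.Chain' at *
    rw [List.isChain_append]
    refine ⟨h3, by simp, ?_⟩
    intro b hb c hc
    rw [h2] at hb
    simp at hb hc
    subst hb; subst hc; exact hyz
  · cases p with
    | nil => simp at h1
    | cons b l => simp at h4 ⊢; omega

lemma path_bound {d : ℕ} (a : Vert d → Vert d → ℝ) (y : Vert d) (i : Fin d) :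
    ∀ (l : List (Vert d)) (x : Vert d), IsOpenPath a x y (x :: l) →
      (y i - x i).natAbs ≤ l.length := by
  intro l
  induction l with
  | nil =>
    intro x h
    have := h.2.1
    simp at this
    subst this; simp
  | cons z l ih =>
    intro x h
    obtain ⟨-, h2, h3⟩ := h
    unfold List.Chain' at h3
    rw [List.isChain_cons_cons] at h3
    have := ih z ⟨by simp, by simpa using h2, h3.2⟩
    have h5 : (x i - z i).natAbs ≤ 1 := by
      have h6 : (∑ i, (x i - z i).natAbs) = 1 := h3.1.1
      rw [← h6]
      exact Finset.single_le_sum (f := fun i => (x i - z i).natAbs) (fun _ _ => Nat.zero_le _)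
        (Finset.mem_univ i)
    simp only [List.length_cons]
    omega

lemma ball_finite {d : ℕ} (a : Vert d → Vert d → ℝ) (x : Vert d) {r : ℝ} (hr : 0 ≤ r) :
    (ballCh a x r).Finite := by
  apply (Set.finite_Icc (fun i => x i - (⌊r⌋₊ : ℤ)) (fun i => x i + (⌊r⌋₊ : ℤ))).subset
  intro y hy
  rw [mem_ball_iff a x y hr] at hy
  obtain ⟨p, hp, hl⟩ := hy
  cases p with
  | nil => simpa using hp.1
  | cons b l =>
    have hb : b = x := by simpa using hp.1
    subst hb
    simp at hl
    constructor <;> intro i <;> have := path_bound a y i l b hp <;> simp only <;> omega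

/-- Linear cutoff between two concentric balls. -/
noncomputable def cutoff {d : ℕ} (a : Vert d → Vert d → ℝ) (x0 : Vert d) (R' R : ℕ)
    (x : Vert d) : ℝ :=
  ((R - R' : ℕ) : ℝ)⁻¹ * ∑ k ∈ Finset.Ico R' R, if x ∈ ballCh a x0 (k : ℝ) then (1 : ℝ) else 0

lemma cutoff_nonneg {d : ℕ} (a : Vert d → Vert d → ℝ) (x0 : Vert d) (R' R : ℕ)
    (x : Vert d) : 0 ≤ cutoff a x0 R' R x := by
  unfold cutoff
  apply mul_nonneg (by positivity)
  apply Finset.sum_nonneg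
  intro k _; split_ifs <;> norm_num

lemma cutoff_le_one {d : ℕ} (a : Vert d → Vert d → ℝ) (x0 : Vert d) {R' R : ℕ} (h : R' < R)
    (x : Vert d) : cutoff a x0 R' R x ≤ 1 := by
  unfold cutoff
  have h1 : (∑ k ∈ Finset.Ico R' R, if x ∈ ballCh a x0 (k : ℝ) then (1 : ℝ) else 0)
      ≤ ∑ k ∈ Finset.Ico R' R, (1 : ℝ) := by
    apply Finset.sum_le_sum
    intro k _; split_ifs <;> norm_num
  rw [Finset.sum_const, Nat.card_Ico, nsmul_eq_mul, mul_one] at h1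
  have h2 : (0 : ℝ) < ((R - R' : ℕ) : ℝ) := by exact_mod_cast Nat.sub_pos_of_lt h
  rw [inv_mul_le_iff₀ h2, mul_one]; exact h1

lemma cutoff_eq_one {d : ℕ} (a : Vert d → Vert d → ℝ) (x0 : Vert d) {R' R : ℕ} (h : R' < R)
    {x : Vert d} (hx : x ∈ ballCh a x0 (R' : ℝ)) : cutoff a x0 R' R x = 1 := by
  unfold cutoff
  have h1 : (∑ k ∈ Finset.Ico R' R, if x ∈ ballCh a x0 (k : ℝ) then (1 : ℝ) else 0)
      = ∑ k ∈ Finset.Ico R' R, (1 : ℝ) := by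
    apply Finset.sum_congr rfl
    intro k hk
    rw [if_pos]
    apply ball_mono a x0 _ hx
    exact_mod_cast (Finset.mem_Ico.1 hk).1
  rw [h1, Finset.sum_const, Nat.card_Ico, nsmul_eq_mul, mul_one]
  have h2 : (0 : ℝ) < ((R - R' : ℕ) : ℝ) := by exact_mod_cast Nat.sub_pos_of_lt h
  exact inv_mul_cancel₀ h2.ne'

lemma cutoff_ne_zero {d : ℕ} (a : Vert d → Vert d → ℝ) (x0 : Vert d) {R' R : ℕ}
    {x : Vert d} (hx : cutoff a x0 R' R x ≠ 0) :
    ∃ k, k + 1 ≤ R ∧ x ∈ ballCh a x0 (k : ℝ) := by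
  by_contra hcon
  push Not at hcon
  apply hx
  unfold cutoff
  rw [Finset.sum_eq_zero, mul_zero]
  intro k hk
  rw [if_neg]
  exact hcon k (Finset.mem_Ico.1 hk).2

lemma cutoff_grad_one {d : ℕ} (a : Vert d → Vert d → ℝ) (x0 : Vert d) {R' R : ℕ} (h : R' < R)
    {x y : Vert d} (hxy : openAdj a x y) :
    cutoff a x0 R' R x - cutoff a x0 R' R y ≤ ((R - R' : ℕ) : ℝ)⁻¹ := by
  unfold cutoff
  have h2 : (0 : ℝ) < ((R - R' : ℕ) : ℝ) := by exact_mod_cast Nat.sub_pos_of_lt h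
  rw [← mul_sub]
  have key : (∑ k ∈ Finset.Ico R' R, if x ∈ ballCh a x0 (k : ℝ) then (1 : ℝ) else 0)
      ≤ 1 + ∑ k ∈ Finset.Ico R' R, if y ∈ ballCh a x0 (k : ℝ) then (1 : ℝ) else 0 := by
    obtain ⟨S, rfl⟩ : ∃ S, R = S + 1 := ⟨R - 1, by omega⟩
    rw [Finset.sum_Ico_succ_top (by omega), Finset.sum_eq_sum_Ico_succ_bot h,
      Finset.sum_Ico_add' (fun k : ℕ => if y ∈ ballCh a x0 (k : ℝ) then (1 : ℝ) else 0) R' S 1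
        |>.symm]
    have h3 : (∑ k ∈ Finset.Ico R' S, if x ∈ ballCh a x0 (k : ℝ) then (1 : ℝ) else 0)
        ≤ ∑ k ∈ Finset.Ico R' S, if y ∈ ballCh a x0 ((k + 1 : ℕ) : ℝ) then (1 : ℝ) else 0 := by
      apply Finset.sum_le_sum
      intro k _
      by_cases hx : x ∈ ballCh a x0 (k : ℝ)
      · rw [if_pos hx, if_pos (ball_succ a x0 hx hxy)]
      · rw [if_neg hx]; split_ifs <;> norm_num
    have h4 : (if x ∈ ballCh a x0 (S : ℝ) then (1 : ℝ) else 0) ≤ 1 := by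
      split_ifs <;> norm_num
    have h5 : (0 : ℝ) ≤ (if y ∈ ballCh a x0 (R' : ℝ) then (1 : ℝ) else 0) := by
      split_ifs <;> norm_num
    linarith only [h3, h4, h5]
  have : ((R - R' : ℕ) : ℝ)⁻¹ = ((R - R' : ℕ) : ℝ)⁻¹ * 1 := by ring
  conv_rhs => rw [this]
  apply mul_le_mul_of_nonneg_left _ (by positivity)
  linarith only [key]

lemma cutoff_grad {d : ℕ} (a : Vert d → Vert d → ℝ) (hs : ∀ x y, a x y = a y x)
    (x0 : Vert d) {R' R : ℕ} (h : R' < R)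
    {x y : Vert d} (hxy : openAdj a x y) :
    (cutoff a x0 R' R y - cutoff a x0 R' R x) ^ 2 ≤ (((R - R' : ℕ) : ℝ)⁻¹) ^ 2 := by
  have h1 := cutoff_grad_one a x0 h hxy
  have h2 := cutoff_grad_one a x0 (R' := R') (R := R) h
    (x := y) (y := x) ⟨adj_symm' hxy.1, by rw [hs]; exact hxy.2⟩
  apply sq_le_sq'
  · linarith only [h1]
  · exact h2

lemma avgNormR_finset {d : ℕ} {p : ℝ≥0∞} (hp : p ≠ ∞) (s : Finset (Vert d)) (f : Vert d → ℝ) :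
    avgNormR p (s : Set (Vert d)) f =
      ((s.card : ℝ)⁻¹ * ∑ x ∈ s, |f x| ^ p.toReal) ^ (1 / p.toReal) := by
  unfold avgNormR
  rw [if_neg hp, Set.ncard_coe_finset, div_eq_inv_mul]
  have := Finset.tsum_subtype s (fun x : Vert d => |f x| ^ p.toReal)
  congr 2

lemma le_avgNormR_top {d : ℕ} (s : Finset (Vert d)) (f : Vert d → ℝ) {x : Vert d} (hx : x ∈ s) :
    |f x| ≤ avgNormR ∞ (s : Set (Vert d)) f := by
  unfold avgNormR
  rw [if_pos rfl]
  apply le_csSup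
  · exact (s.finite_toSet.image _).bddAbove
  · exact ⟨x, hx, rfl⟩

lemma avgNormR_nonneg {d : ℕ} (p : ℝ≥0∞) (s : Finset (Vert d)) (f : Vert d → ℝ) :
    0 ≤ avgNormR p (s : Set (Vert d)) f := by
  by_cases hp : p = ∞
  · unfold avgNormR
    rw [if_pos hp]
    apply Real.sSup_nonneg
    rintro _ ⟨x, _, rfl⟩
    exact abs_nonneg _
  · rw [avgNormR_finset hp]
    apply Real.rpow_nonneg
    apply mul_nonneg (by positivity)
    apply Finset.sum_nonneg
    intro x _
    exact Real.rpow_nonneg (abs_nonneg _) _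

lemma one_le_avgNormR {d : ℕ} {p : ℝ≥0∞} (hp1 : 1 < p) (s : Finset (Vert d)) (hs : s.Nonempty)
    (f : Vert d → ℝ) (hf : ∀ x, 1 ≤ f x) :
    1 ≤ avgNormR p (s : Set (Vert d)) f := by
  obtain ⟨x, hx⟩ := hs
  by_cases hp : p = ∞
  · subst hp
    exact ((hf x).trans (le_abs_self _)).trans (le_avgNormR_top s f hx)
  · rw [avgNormR_finset hp]
    apply Real.one_le_rpow _ (by positivity)
    have hc : (0 : ℝ) < s.card := by exact_mod_cast Finset.card_pos.2 ⟨x, hx⟩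
    rw [← inv_mul_cancel₀ hc.ne']
    apply mul_le_mul_of_nonneg_left _ (by positivity)
    have : (s.card : ℝ) = ∑ x ∈ s, (1 : ℝ) := by simp
    rw [this]
    apply Finset.sum_le_sum
    intro y _
    exact Real.one_le_rpow ((hf y).trans (le_abs_self _)) (by positivity)

/-- Averages are dominated by pointwise bounds. -/
lemma avgNormR_le_of_forall {d : ℕ} {p : ℝ≥0∞} (hp1 : 1 < p) (s : Finset (Vert d))
    (f : Vert d → ℝ) {K : ℝ} (hK : 0 ≤ K) (hf : ∀ x ∈ s, |f x| ≤ K) :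
    avgNormR p (s : Set (Vert d)) f ≤ K := by
  by_cases hp : p = ∞
  · unfold avgNormR
    rw [if_pos hp]
    apply Real.sSup_le _ hK
    rintro _ ⟨x, hx, rfl⟩
    exact hf x hx
  · rw [avgNormR_finset hp]
    have hp0 : 0 < p.toReal := ENNReal.toReal_pos (by rintro rfl; simp at hp1) hp
    rw [one_div]
    apply (Real.rpow_inv_le_iff_of_pos _ hK hp0).2
    · rcases s.eq_empty_or_nonempty with rfl | hs
      · simp; positivity
      have hc : (0 : ℝ) < s.card := by exact_mod_cast Finset.card_pos.2 hs
      rw [inv_mul_le_iff₀ hc]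
      calc ∑ x ∈ s, |f x| ^ p.toReal ≤ ∑ x ∈ s, K ^ p.toReal := by
            apply Finset.sum_le_sum
            intro x hx
            exact Real.rpow_le_rpow (abs_nonneg _) (hf x hx) hp0.le
        _ = s.card * K ^ p.toReal := by simp
    · apply mul_nonneg (by positivity)
      apply Finset.sum_nonneg
      intro x _
      exact Real.rpow_nonneg (abs_nonneg _) _

lemma holder_avg_real {ι : Type*} (s : Finset ι) {N Q Qs : ℝ} (hN : 0 < N)
    (hQ : Q.HolderConjugate Qs) (g k : ι → ℝ) (hk : ∀ x, 0 ≤ k x) :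
    ∑ x ∈ s, g x * k x ≤ N * (N⁻¹ * ∑ x ∈ s, |g x| ^ Q) ^ (1 / Q) *
      (N⁻¹ * ∑ x ∈ s, k x ^ Qs) ^ (1 / Qs) := by
  have h := Real.inner_le_Lp_mul_Lq s g k hQ
  have h2 : ∑ x ∈ s, |k x| ^ Qs = ∑ x ∈ s, k x ^ Qs := by
    apply Finset.sum_congr rfl
    intro x _; rw [abs_of_nonneg (hk x)]
  rw [h2] at h
  refine h.trans (le_of_eq ?_)
  have hA : 0 ≤ ∑ x ∈ s, |g x| ^ Q :=
    Finset.sum_nonneg fun x _ => Real.rpow_nonneg (abs_nonneg _) _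
  have hB : 0 ≤ ∑ x ∈ s, k x ^ Qs :=
    Finset.sum_nonneg fun x _ => Real.rpow_nonneg (hk x) _
  rw [Real.mul_rpow (by positivity) hA, Real.mul_rpow (by positivity) hB]
  have h3 : N * ((N⁻¹) ^ (1 / Q) * (N⁻¹) ^ (1 / Qs)) = 1 := by
    rw [← Real.rpow_add (by positivity)]
    have : 1 / Q + 1 / Qs = 1 := by
      have := hQ.inv_add_inv_eq_one
      rw [one_div, one_div]; exact this
    rw [this, Real.rpow_one, mul_inv_cancel₀ hN.ne']
  linear_combination (-(∑ x ∈ s, |g x| ^ Q) ^ (1 / Q) * (∑ x ∈ s, k x ^ Qs) ^ (1 / Qs)) * h3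

lemma pstar_props {p : ℝ≥0∞} (hp : 1 < p) :
    pstar p ≠ ∞ ∧ 1 ≤ (pstar p).toReal ∧ 1 / (pstar p).toReal = 1 - (1 / p).toReal ∧
      0 ≤ (1 / p).toReal ∧
      (p ≠ ∞ → p.toReal.HolderConjugate (pstar p).toReal) := by
  unfold pstar
  by_cases h : p = ∞
  · subst h; simp
  · rw [if_neg h]
    have h1 : 1 < p.toReal := by
      rw [← ENNReal.toReal_one]
      exact (ENNReal.toReal_lt_toReal (by simp) h).2 hp
    have h2 : 1 ≤ p.toReal / (p.toReal - 1) := by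
      rw [le_div_iff₀ (by linarith)]; linarith
    rw [ENNReal.toReal_ofReal (by linarith)]
    refine ⟨ENNReal.ofReal_ne_top, h2, ?_, ENNReal.toReal_nonneg, fun _ => ?_⟩
    · rw [ENNReal.toReal_div, ENNReal.toReal_one]
      field_simp
    · rw [Real.holderConjugate_iff]
      refine ⟨h1, ?_⟩
      field_simp
      ring

lemma holder_avg {d : ℕ} {p : ℝ≥0∞} (hp : 1 < p) (s : Finset (Vert d)) (hs : s.Nonempty)
    (g k : Vert d → ℝ) (hk : ∀ x, 0 ≤ k x) :
    ∑ x ∈ s, g x * k x ≤ s.card * avgNormR p (s : Set (Vert d)) g *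
      ((s.card : ℝ)⁻¹ * ∑ x ∈ s, k x ^ (pstar p).toReal) ^ (1 / (pstar p).toReal) := by
  have hc : (0 : ℝ) < s.card := by exact_mod_cast Finset.card_pos.2 hs
  by_cases h : p = ∞
  · subst h
    simp only [pstar, if_true, ENNReal.toReal_one, Real.rpow_one, div_one]
    calc ∑ x ∈ s, g x * k x ≤ ∑ x ∈ s, avgNormR ∞ (s : Set (Vert d)) g * k x := by
          apply Finset.sum_le_sum
          intro x hx
          exact mul_le_mul_of_nonneg_right ((le_abs_self _).trans (le_avgNormR_top s g hx)) (hk x)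
      _ = _ := by
          rw [← Finset.mul_sum]; field_simp
  · rw [avgNormR_finset h]
    exact holder_avg_real s hc ((pstar_props hp).2.2.2.2 h) g k hk

lemma exists_Q {q : ℝ≥0∞} (hq : 1 < q) {ip t : ℝ} (h : ip + (1 / q).toReal < t) :
    ∃ Q : ℝ, 1 < Q ∧ ip + 1 / Q < t ∧ ∀ (d : ℕ) (s : Finset (Vert d)) (g : Vert d → ℝ),
      ((s.card : ℝ)⁻¹ * ∑ x ∈ s, |g x| ^ Q) ^ (1 / Q) ≤ avgNormR q (s : Set (Vert d)) g := by
  by_cases hq' : q = ∞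
  · subst hq'
    simp at h
    refine ⟨2 + 1 / (t - ip), ?_, ?_, ?_⟩
    · have : 0 < 1 / (t - ip) := by apply one_div_pos.2; linarith
      linarith
    · have h1 : 0 < t - ip := by linarith
      have : 1 / (2 + 1 / (t - ip)) < t - ip := by
        rw [div_lt_iff₀ (by positivity)]
        have : (t - ip) * (2 + 1 / (t - ip)) = 2 * (t - ip) + 1 := by field_simp
        linarith
      linarith
    · intro d s g
      have h1 : 0 < t - ip := by linarith
      have hQ : (1 : ℝ) < 2 + 1 / (t - ip) := by
        have : 0 < 1 / (t - ip) := one_div_pos.2 h1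
        linarith
      have := avgNormR_le_of_forall (p := ENNReal.ofReal (2 + 1 / (t - ip)))
        (by rw [← ENNReal.ofReal_one]; exact (ENNReal.ofReal_lt_ofReal_iff (by linarith)).2 hQ)
        s g (avgNormR_nonneg ∞ s g) (fun x hx => le_avgNormR_top s g hx)
      rw [avgNormR_finset ENNReal.ofReal_ne_top, ENNReal.toReal_ofReal (by linarith)] at this
      exact this
  · refine ⟨q.toReal, ?_, ?_, ?_⟩
    · rw [← ENNReal.toReal_one]
      exact (ENNReal.toReal_lt_toReal (by simp) hq').2 hq
    · rw [ENNReal.toReal_div, ENNReal.toReal_one] at h; exact h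
    · intro d s g
      rw [avgNormR_finset hq']

lemma params_exist {d' Q ip P : ℝ} (hd' : 2 ≤ d') (hQ : 1 < Q) (hip : 0 ≤ ip)
    (h : ip + 1 / Q < 2 / d') (hP : 1 ≤ P) (hPi : 1 / P = 1 - ip) :
    ∃ s r Qs ρ : ℝ, r = d' / (d' - 1) ∧ 1 < s ∧ 0 < r ∧ 0 < Qs ∧ s * r = 2 * (s - 1) * Qs ∧
      0 < 1 / ρ ∧ 2 / r - 1 / Qs = 1 / ρ ∧ s * r = 2 * ρ ∧ P < ρ ∧ 1 / P - 1 / ρ ≤ 2 / d' ∧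
      Q.HolderConjugate Qs := by
  have hd1 : 0 < d' - 1 := by linarith
  have hQ1 : 0 < Q - 1 := by linarith
  have hr : 0 < d' / (d' - 1) := by positivity
  have hr2 : d' / (d' - 1) ≤ 2 := by rw [div_le_iff₀ hd1]; linarith
  have hQs1 : 1 < Q / (Q - 1) := by rw [lt_div_iff₀ hQ1]; linarith
  have hQi : 0 < 1 / Q := by positivity
  have hdi : 2 / d' ≤ 1 := by rw [div_le_iff₀ (by linarith)]; linarith
  obtain ⟨r, hrr⟩ : ∃ r, r = d' / (d' - 1) := ⟨_, rfl⟩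
  obtain ⟨Qs, hQs⟩ : ∃ Qs, Qs = Q / (Q - 1) := ⟨_, rfl⟩
  have e1 : 2 / r = 2 - 2 / d' := by rw [hrr]; field_simp
  have e2 : 1 / Qs = 1 - 1 / Q := by rw [hQs]; field_simp
  rw [← hrr] at hr hr2
  rw [← hQs] at hQs1
  have hD : 0 < 2 * Qs - r := by linarith
  have hQs0 : 0 < Qs := by linarith
  have hs : 1 < 2 * Qs / (2 * Qs - r) := by rw [lt_div_iff₀ hD]; linarith
  have e3 : 2 / r - 1 / Qs = 1 / (2 * Qs / (2 * Qs - r) * r / 2) := by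
    field_simp
  have hρ : 0 < 2 * Qs / (2 * Qs - r) * r / 2 := by positivity
  have e4 : 1 / (2 * Qs / (2 * Qs - r) * r / 2) = 1 - 2 / d' + 1 / Q := by
    rw [← e3, e1, e2]; ring
  refine ⟨2 * Qs / (2 * Qs - r), r, Qs, 2 * Qs / (2 * Qs - r) * r / 2, hrr, hs, hr, hQs0, ?_,
    one_div_pos.2 hρ, e3, by ring, ?_, ?_, ?_⟩
  · field_simp; ring
  · apply (one_div_lt_one_div hρ (by linarith)).1
    rw [e4, hPi]; linarith
  · rw [e4, hPi]; linarith
  · rw [Real.holderConjugate_iff]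
    refine ⟨hQ, ?_⟩
    rw [← one_div, ← one_div, e2]; ring

lemma row_sum {d : ℕ} (F : Finset (Vert d)) (x : Vert d) (hF : nbrs x ⊆ F) (f : Vert d → ℝ) :
    ∑ y ∈ F, (if adj x y then f y else 0) = ∑ y ∈ nbrs x, f y := by
  rw [← Finset.sum_filter]
  apply Finset.sum_congr _ (fun _ _ => rfl)
  ext y
  simp only [Finset.mem_filter, adj_iff_nbrs]
  exact ⟨fun h => h.2, fun h => ⟨hF h, h⟩⟩

lemma edgeGradSum_eq {d : ℕ} (a : Vert d → Vert d → ℝ) (B F : Finset (Vert d)) (hBF : B ⊆ F)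
    (hF : ∀ x ∈ B, nbrs x ⊆ F) (g : Vert d → ℝ) (hg : ∀ x, x ∉ B → g x = 0) :
    edgeGradSum a g = (1 / 2) * ∑ x ∈ F, ∑ y ∈ F, if openAdj a x y then |g y - g x| else 0 := by
  unfold edgeGradSum
  rw [tsum_eq_sum (s := F ×ˢ F), Finset.sum_product]
  rintro ⟨x, y⟩ he
  simp only [Finset.mem_product, not_and_or] at he ⊢
  split_ifs with ho
  · have hx : x ∉ B := by
      intro hx
      rcases he with h | h
      · exact h (hBF hx)
      · exact h (hF x hx ((adj_iff_nbrs x y).1 ho.1))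
    have hy : y ∉ B := by
      intro hy
      rcases he with h | h
      · exact h (hF y hy ((adj_iff_nbrs y x).1 (adj_symm' ho.1)))
      · exact h (hBF hy)
    rw [hg x hx, hg y hy]; simp
  · rfl

lemma avgNormR_neg {d : ℕ} (p : ℝ≥0∞) (A : Set (Vert d)) (f : Vert d → ℝ) :
    avgNormR p A (fun x => - f x) = avgNormR p A f := by
  unfold avgNormR
  simp only [abs_neg]

lemma vol_rpow {N C n e : ℝ} {d : ℕ} (hd : 2 ≤ d) (hN : 1 ≤ N) (hC : 1 ≤ C) (hn : 0 ≤ n)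
    (h : N ≤ C * n ^ d) (he : e ≤ 2 / d) : N ^ e ≤ C * n ^ 2 := by
  have hd0 : (0 : ℝ) < d := by exact_mod_cast (by omega : 0 < d)
  calc N ^ e ≤ N ^ (2 / (d : ℝ)) := Real.rpow_le_rpow_of_exponent_le hN he
    _ ≤ (C * n ^ d) ^ (2 / (d : ℝ)) := Real.rpow_le_rpow (by linarith) h (by positivity)
    _ = C ^ (2 / (d : ℝ)) * n ^ 2 := by
        rw [Real.mul_rpow (by linarith) (by positivity), ← Real.rpow_natCast n d,
          ← Real.rpow_mul hn]
        have : (d : ℝ) * (2 / d) = (2 : ℕ) := by push_cast; field_simp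
        rw [this, Real.rpow_natCast]
    _ ≤ C * n ^ 2 := by
        apply mul_le_mul_of_nonneg_right _ (by positivity)
        conv_rhs => rw [← Real.rpow_one C]
        apply Real.rpow_le_rpow_of_exponent_le hC
        rw [div_le_one hd0]
        exact_mod_cast hd

lemma const_arith {s K α ν μ Γ w n δ T : ℝ} (hν : 0 ≤ ν) (hμ : 1 ≤ μ)
    (hΓ : 0 ≤ Γ) (hn : 0 < n) (hδ : 0 < δ) (hδ1 : δ ≤ 1) (hw : w * (n ^ 2 * δ ^ 2) ≤ 4)
    (hT : 0 ≤ T) :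
    320 * s ^ 2 * (K * n / 2) ^ 2 * ν * α ^ 2 * (w * μ + 2 * Γ) * T ≤
      (320 * s ^ 2 * K ^ 2) * α ^ 2 * (μ * ν * (1 + Γ * n ^ 2) / δ ^ 2) * T := by
  apply mul_le_mul_of_nonneg_right _ hT
  have key : n ^ 2 * (w * μ + 2 * Γ) ≤ 4 * (μ * (1 + Γ * n ^ 2) / δ ^ 2) := by
    rw [mul_div_assoc', le_div_iff₀ (by positivity)]
    have hδ2 : δ ^ 2 ≤ 1 := by nlinarith only [hδ, hδ1]
    have h1 : μ * (w * (n ^ 2 * δ ^ 2)) ≤ μ * 4 :=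
      mul_le_mul_of_nonneg_left hw (by linarith)
    have h0 : 0 ≤ Γ * n ^ 2 := by positivity
    have h2 : Γ * n ^ 2 * δ ^ 2 ≤ Γ * n ^ 2 * 1 := mul_le_mul_of_nonneg_left hδ2 h0
    have h3 : Γ * n ^ 2 * 1 ≤ Γ * n ^ 2 * μ := mul_le_mul_of_nonneg_left hμ h0
    linarith only [h1, h2, h3, h0]
  have h4 : 0 ≤ 80 * s ^ 2 * K ^ 2 * ν * α ^ 2 := by positivity
  have h5 := mul_le_mul_of_nonneg_left key h4
  calc _ = 80 * s ^ 2 * K ^ 2 * ν * α ^ 2 * (n ^ 2 * (w * μ + 2 * Γ)) := by ring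
    _ ≤ _ := h5
    _ = _ := by ring

lemma gap_arith {σ' σ n : ℝ} (h0 : 0 ≤ σ') (hn : 0 < n) (hgap : 2 ≤ (σ - σ') * n) :
    ⌊σ' * n⌋₊ < ⌊σ * n⌋₊ ∧
    (((⌊σ * n⌋₊ - ⌊σ' * n⌋₊ : ℕ) : ℝ)⁻¹) ^ 2 * (n ^ 2 * (σ - σ') ^ 2) ≤ 4 := by
  have h1 : σ * n < ⌊σ * n⌋₊ + 1 := Nat.lt_floor_add_one _
  have h2 : (⌊σ' * n⌋₊ : ℝ) ≤ σ' * n := Nat.floor_le (by positivity)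
  have h3 : (σ - σ') * n / 2 ≤ (⌊σ * n⌋₊ : ℝ) - ⌊σ' * n⌋₊ := by linarith
  have hlt : ⌊σ' * n⌋₊ < ⌊σ * n⌋₊ := by
    have : (⌊σ' * n⌋₊ : ℝ) < ⌊σ * n⌋₊ := by linarith
    exact_mod_cast this
  refine ⟨hlt, ?_⟩
  rw [Nat.cast_sub hlt.le]
  set D : ℝ := (⌊σ * n⌋₊ : ℝ) - ⌊σ' * n⌋₊
  have hD : 0 < D := by linarith
  rw [inv_pow, inv_mul_le_iff₀ (by positivity)]
  nlinarith only [h3, hD, hgap]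

/-- The concrete Moser step on the chemical-distance balls, for a large gap. -/
lemma concrete_step_large {d : ℕ} {d' CS1 : ℝ} {p q : ℝ≥0∞} (hp : 1 < p) (hq : 1 < q)
    {Q s r Qs ρ : ℝ}
    (hQ3 : ∀ (d : ℕ) (s : Finset (Vert d)) (g : Vert d → ℝ),
      ((s.card : ℝ)⁻¹ * ∑ x ∈ s, |g x| ^ Q) ^ (1 / Q) ≤ avgNormR q (s : Set (Vert d)) g)
    (hrd : r = d' / (d' - 1)) (hs1 : 1 < s) (hr : 0 < r) (hQs : 0 < Qs)
    (hsr : s * r = 2 * (s - 1) * Qs) (hpos : 0 < 1 / ρ) (hρ1 : 2 / r - 1 / Qs = 1 / ρ)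
    (hρ2 : s * r = 2 * ρ) (hconj : Q.HolderConjugate Qs)
    (hCS1 : 1 ≤ CS1)
    (a : Vert d → Vert d → ℝ) (has : ∀ x y, a x y = a y x) (ha : ∀ x y, 0 ≤ a x y)
    (κ : Vert d → ℝ) (hκ : ∀ x, 0 < κ x) (h : ℝ) (hh : 0 ≤ h)
    (x0 : Vert d) (n : ℕ) (hn : 0 < n)
    (B : Finset (Vert d)) (hB : (B : Set (Vert d)) = ballCh a x0 (n : ℝ)) (hBne : B.Nonempty)
    (hSob : ∀ f : Vert d → ℝ, (∀ y, f y ≠ 0 → y ∈ ballCh a x0 n) →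
      avgNormR (ENNReal.ofReal (d' / (d' - 1))) (ballCh a x0 n) f ≤
        CS1 * n / ((ballCh a x0 n).ncard : ℝ) * edgeGradSum a f)
    (u : Vert d → ℝ) (hu : ∀ x, 0 ≤ u x)
    (hL : ∀ x ∈ ballCh a x0 (n : ℝ), 0 ≤ genL a κ h u x)
    (phi : Vert d → ℝ) (hphi : ∀ x, 0 < phi x)
    (σ' σ α : ℝ) (h1 : 1 / 2 ≤ σ') (h2 : σ' < σ) (h3 : σ ≤ 1) (hα : 1 ≤ α)
    (hgap : 2 ≤ (σ - σ') * n) :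
    ((B.card : ℝ)⁻¹ * ∑ x ∈ B.filter (· ∈ ballCh a x0 (σ' * n)),
        (phi x * u x) ^ (2 * α * ρ)) ^ (1 / ρ) ≤
      (320 * s ^ 2 * CS1 ^ 2) * α ^ 2 * (mBound a p q phi x0 n / (σ - σ') ^ 2) *
        ((B.card : ℝ)⁻¹ * ∑ x ∈ B.filter (· ∈ ballCh a x0 (σ * n)),
          (phi x * u x) ^ (2 * α * (pstar p).toReal)) ^ (1 / (pstar p).toReal) := by
  have hn0 : (0 : ℝ) < n := by exact_mod_cast hn
  obtain ⟨-, hP1, -, -, -⟩ := pstar_props hp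
  have hc : (0 : ℝ) < B.card := by exact_mod_cast Finset.card_pos.2 hBne
  obtain ⟨hlt, hw⟩ := gap_arith (by linarith : (0:ℝ) ≤ σ') hn0 hgap
  set R := ⌊σ * n⌋₊ with hR
  set R' := ⌊σ' * n⌋₊ with hR'
  have hbR : ballCh a x0 (σ * n) = ballCh a x0 (R : ℝ) :=
    ball_floor a x0 (mul_nonneg (by linarith) hn0.le)
  have hbR' : ballCh a x0 (σ' * n) = ballCh a x0 (R' : ℝ) :=
    ball_floor a x0 (mul_nonneg (by linarith) hn0.le)
  have hmem : ∀ x, x ∈ ballCh a x0 (R : ℝ) → x ∈ B.filter (· ∈ ballCh a x0 (σ * n)) := by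
    intro x hx
    rw [← hbR] at hx
    refine Finset.mem_filter.2 ⟨?_, hx⟩
    rw [← Finset.mem_coe, hB]
    refine ball_mono a x0 ?_ hx
    calc σ * n ≤ 1 * n := mul_le_mul_of_nonneg_right h3 hn0.le
      _ = n := one_mul _
  set c : Vert d → Vert d → ℝ := fun x y => if adj x y then a x y else 0 with hcdef
  have hc0 : ∀ x y, 0 ≤ c x y := by
    intro x y; simp only [hcdef]; split_ifs
    · exact ha x y
    · exact le_rfl
  have hcs : ∀ x y, c x y = c y x := by
    intro x y
    simp only [hcdef]
    by_cases hxy : adj x y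
    · rw [if_pos hxy, if_pos (adj_symm' hxy), has]
    · rw [if_neg hxy, if_neg (fun h => hxy (adj_symm' h))]
  have hcpos : ∀ x y, 0 < c x y ↔ openAdj a x y := by
    intro x y
    simp only [hcdef, openAdj]
    by_cases hxy : adj x y
    · simp [hxy]
    · simp [hxy]
  have hcne : ∀ x y, c x y ≠ 0 → openAdj a x y := fun x y hxy =>
    (hcpos x y).1 (lt_of_le_of_ne (hc0 x y) (Ne.symm hxy))
  set F : Finset (Vert d) := B ∪ B.biUnion nbrs with hF
  have hBF : B ⊆ F := Finset.subset_union_left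
  have hnF : ∀ x ∈ B, nbrs x ⊆ F := fun x hx y hy =>
    Finset.mem_union_right _ (Finset.mem_biUnion.2 ⟨x, hx, hy⟩)
  set μn := avgNormR p (B : Set (Vert d)) (fun x => max 1 (muA a x)) with hμn
  set νn := avgNormR q (B : Set (Vert d)) (fun x => max 1 (nuA a x)) with hνn
  set Γn := avgNormR p (B : Set (Vert d)) (carre a phi fun z => (phi z)⁻¹) with hΓn
  have hm : mBound a p q phi x0 n = μn * νn * (1 + Γn * (n : ℝ) ^ 2) := by
    unfold mBound
    rw [← hB]
  have hμ1 : 1 ≤ μn := one_le_avgNormR hp B hBne _ (fun x => le_max_left _ _)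
  have hν0 : 0 ≤ νn := avgNormR_nonneg _ _ _
  have hΓ0 : 0 ≤ Γn := avgNormR_nonneg _ _ _
  have hSN : CS1 * n / B.card * (1 / 2) * B.card = CS1 * n / 2 := by
    field_simp
  have main := moser_step F B (B.filter (· ∈ ballCh a x0 (σ * n)))
    (B.filter (· ∈ ballCh a x0 (σ' * n))) hBF (Finset.filter_subset _ _)
    (by
      intro x hx
      rw [Finset.mem_filter] at hx ⊢
      exact ⟨hx.1, ball_mono a x0 (mul_le_mul_of_nonneg_right h2.le hn0.le) hx.2⟩)
    c hcs hc0 u phi (cutoff a x0 R' R) (fun x => max 1 (nuA a x)) (fun x => max 1 (muA a x))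
    (fun x => - carre a phi (fun z => (phi z)⁻¹) x) hu hphi
    (cutoff_nonneg a x0 R' R) (cutoff_le_one a x0 hlt)
    (by
      intro x hx
      rw [Finset.mem_filter, hbR'] at hx
      exact cutoff_eq_one a x0 hlt hx.2)
    (by
      intro x hx
      by_contra hne
      obtain ⟨k, hk, hxk⟩ := cutoff_ne_zero a x0 hne
      exact hx (hmem x (ball_mono a x0 (by exact_mod_cast (by omega : k ≤ R)) hxk)))
    (by
      intro x y hxy hne
      obtain ⟨k, hk, hxk⟩ := cutoff_ne_zero a x0 hne
      exact hmem y (ball_mono a x0 (by exact_mod_cast hk) (ball_succ a x0 hxk (hcne x y hxy))))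
    (w2 := (((R - R' : ℕ) : ℝ)⁻¹) ^ 2) (by positivity)
    (fun x y hxy => cutoff_grad a has x0 hlt (hcne x y hxy))
    (by
      intro x hx
      have hxb : x ∈ ballCh a x0 (n : ℝ) := by rw [← hB]; exact hx
      have hg := hL x hxb
      unfold genL at hg
      have hk : 0 ≤ h * κ x * u x := mul_nonneg (mul_nonneg hh (hκ x).le) (hu x)
      have : ∑ y ∈ F, c x y * (u y - u x) = ∑ y ∈ nbrs x, a x y * (u y - u x) := by
        rw [← row_sum F x (hnF x hx)]
        apply Finset.sum_congr rfl
        intro y _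
        simp only [hcdef, ite_mul, zero_mul]
      rw [this]; linarith)
    (by
      intro x hx
      refine le_trans (le_of_eq ?_) (le_max_right _ _)
      unfold nuA
      rw [← row_sum F x (hnF x hx)]
      apply Finset.sum_congr rfl
      intro y _
      by_cases hxy : adj x y
      · simp only [hcdef, if_pos hxy]
      · simp only [hcdef, if_neg hxy]; simp)
    (by
      intro x hx
      refine le_trans (le_of_eq ?_) (le_max_right _ _)
      unfold muA
      rw [← row_sum F x (hnF x hx)])
    (by
      intro x hx
      refine le_of_eq ?_
      unfold carre
      rw [← Finset.sum_neg_distrib, ← row_sum F x (hnF x hx)]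
      apply Finset.sum_congr rfl
      intro y _
      by_cases hxy : adj x y
      · simp only [hcdef, if_pos hxy]; ring
      · simp only [hcdef, if_neg hxy]; ring)
    (s := s) (r := r) (Qs := Qs) (P := (pstar p).toReal) (N := B.card)
    (S := CS1 * n / B.card * (1 / 2)) (νn := νn) (μn := μn) (Γn := Γn) (α := α) (ρ := ρ)
    hs1 hr hQs (by linarith) hc (by positivity) hsr hpos hρ1 hρ2 hν0 hα
    (by
      intro k hk
      refine (holder_avg_real B hc hconj _ k hk).trans ?_
      apply mul_le_mul_of_nonneg_right
      · exact mul_le_mul_of_nonneg_left (hQ3 d B _) hc.le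
      · apply Real.rpow_nonneg
        apply mul_nonneg (by positivity)
        exact Finset.sum_nonneg fun x _ => Real.rpow_nonneg (hk x) _)
    (fun k hk => holder_avg hp B hBne _ k hk)
    (by
      intro k hk
      have := holder_avg hp B hBne (fun x => - carre a phi (fun z => (phi z)⁻¹) x) k hk
      rw [avgNormR_neg] at this
      exact this)
    (by
      intro g hg hg0
      have h5 := hSob g (fun y hy => by
        rw [← hB]
        by_contra hcon
        exact hy (hg0 y hcon))
      rw [← hB, avgNormR_finset ENNReal.ofReal_ne_top, Set.ncard_coe_finset,
        edgeGradSum_eq a B F hBF hnF g hg0, ← hrd, ENNReal.toReal_ofReal hr.le] at h5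
      have e1 : ∑ x ∈ B, |g x| ^ r = ∑ x ∈ B, g x ^ r :=
        Finset.sum_congr rfl fun x _ => by rw [abs_of_nonneg (hg x)]
      rw [e1] at h5
      refine h5.trans (le_of_eq ?_)
      rw [← mul_assoc]
      congr 1
      apply Finset.sum_congr rfl
      intro x _
      apply Finset.sum_congr rfl
      intro y _
      simp only [hcpos])
  refine main.trans ?_
  rw [hSN, hm]
  apply const_arith hν0 hμ1 hΓ0 hn0 (by linarith) (by linarith) hw
  apply Real.rpow_nonneg
  apply mul_nonneg (by positivity)
  exact Finset.sum_nonneg fun x _ => Real.rpow_nonneg (mul_nonneg (hphi x).le (hu x)) _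

lemma concrete_step_small {d : ℕ} (hd : 2 ≤ d) {d' Creg : ℝ} (hdd : (d : ℝ) ≤ d')
    {P ρ : ℝ} (hP : 1 ≤ P) (hPρ : P < ρ) (hPe : 1 / P - 1 / ρ ≤ 2 / d') (hCreg : 1 ≤ Creg)
    {ι : Type*} (B Bs Bs' : Finset ι) (hB : Bs' ⊆ Bs) (hBne : B.Nonempty) (n : ℕ)
    (hvol : (B.card : ℝ) ≤ Creg * (n : ℝ) ^ d) (v : ι → ℝ) (hv : ∀ x, 0 ≤ v x)
    {δ α M : ℝ} (hδ : 0 < δ) (hα : 1 ≤ α) (hM : 1 ≤ M)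
    (hgap : δ * n < 2) :
    ((B.card : ℝ)⁻¹ * ∑ x ∈ Bs', v x ^ (2 * α * ρ)) ^ (1 / ρ) ≤
      (4 * Creg) * α ^ 2 * (M / δ ^ 2) *
        ((B.card : ℝ)⁻¹ * ∑ x ∈ Bs, v x ^ (2 * α * P)) ^ (1 / P) := by
  have hc : (1 : ℝ) ≤ B.card := by exact_mod_cast Finset.card_pos.2 hBne
  refine (trivial_step Bs Bs' hB v hv (by linarith) (by linarith) hPρ.le).trans ?_
  apply mul_le_mul_of_nonneg_right
  · have hd0 : (0 : ℝ) < d := by exact_mod_cast (by omega : 0 < d)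
    have he : 1 / P - 1 / ρ ≤ 2 / d :=
      hPe.trans (div_le_div_of_nonneg_left (by norm_num) hd0 hdd)
    have hn : (0 : ℝ) ≤ n := Nat.cast_nonneg n
    refine (vol_rpow hd hc hCreg hn hvol he).trans ?_
    have h1 : (n : ℝ) ^ 2 ≤ 4 / δ ^ 2 := by
      rw [le_div_iff₀ (by positivity)]
      have h0 : 0 ≤ δ * n := by positivity
      nlinarith only [h0, hgap]
    have hα2 : 1 ≤ α ^ 2 := one_le_pow₀ hα
    have hαM : 1 ≤ α ^ 2 * M := one_le_mul_of_one_le_of_one_le hα2 hM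
    calc Creg * (n : ℝ) ^ 2 ≤ Creg * (4 / δ ^ 2) := mul_le_mul_of_nonneg_left h1 (by linarith)
      _ = (Creg * (4 / δ ^ 2)) * 1 := by ring
      _ ≤ (Creg * (4 / δ ^ 2)) * (α ^ 2 * M) := mul_le_mul_of_nonneg_left hαM (by positivity)
      _ = _ := by ring
  · apply Real.rpow_nonneg
    apply mul_nonneg (by positivity)
    exact Finset.sum_nonneg fun x _ => Real.rpow_nonneg (hv x) _

/-- Proposition `prop:mos_it`, Moser iteration: under the graph
assumption, for `u ≥ 0` with `ℒu ≥ 0` on `B(1) = B^ω(x₀,n)` and `v = φ·u`, for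
`p, q` with `1/p + 1/q < 2/d'` there are `γ' > 1` and `c₃₆` such that for all
`β ∈ [2p_*, ∞]` and `1/2 ≤ σ' < σ ≤ 1`,
`‖v‖_{β,B(σ')} ≤ c₃₆ (m^ω(n)/(σ-σ')²)^{γ'} ‖v‖_{2p_*,B(σ)}`. -/
theorem statement17
    {d : ℕ} (hd : 2 ≤ d) (d' Creg CS1 : ℝ)
    (p q : ℝ≥0∞) (hp : 1 < p) (hq : 1 < q)
    (hpq : 1 / p + 1 / q < ENNReal.ofReal (2 / d')) :
    ∃ γ' c36 : ℝ, 1 < γ' ∧ 0 < c36 ∧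
      ∀ (a : Vert d → Vert d → ℝ), (∀ x y, a x y = a y x) → (∀ x y, 0 ≤ a x y) →
      ∀ κ : Vert d → ℝ, (∀ x, 0 < κ x) → ∀ h ∈ Set.Icc (0:ℝ) 1,
      ∀ N4 N5 : Vert d → ℕ, GraphAssumption d' a N4 N5 Creg CS1 →
      ∀ x0 ∈ Cinf a, ∀ n : ℕ, 2 * max (N4 x0) (N5 x0) ≤ n →
      ∀ u : Vert d → ℝ, (∀ x, 0 ≤ u x) →
        (∀ x ∈ ballCh a x0 (n : ℝ), 0 ≤ genL a κ h u x) →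
      ∀ phi : Vert d → ℝ, (∀ x, 0 < phi x) →
      ∀ β : ℝ≥0∞, 2 * pstar p ≤ β →
      ∀ σ' σ : ℝ, 1 / 2 ≤ σ' → σ' < σ → σ ≤ 1 →
        avgNormR β (ballCh a x0 (σ' * n)) (fun z => phi z * u z) ≤
          c36 * (mBound a p q phi x0 n / (σ - σ') ^ 2) ^ γ' *
            avgNormR (2 * pstar p) (ballCh a x0 (σ * n))
              (fun z => phi z * u z) := by
  have hdd2 : (2 : ℝ) ≤ d := by exact_mod_cast hd
  by_cases hpar : (d : ℝ) ≤ d' ∧ 1 ≤ Creg ∧ 1 ≤ CS1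
  swap
  · refine ⟨2, 1, by norm_num, by norm_num, ?_⟩
    intro a _ _ κ _ h _ N4 N5 hG
    exact absurd ⟨hG.2.2.1, hG.1, hG.2.1⟩ hpar
  obtain ⟨hdd, hCreg, hCS1⟩ := hpar
  obtain ⟨hps, hP1, hPi, hip, -⟩ := pstar_props hp
  have hpq' : (1 / p).toReal + (1 / q).toReal < 2 / d' := by
    have hp1 : 1 / p ≠ ∞ := (ENNReal.div_lt_top (by simp) (by rintro rfl; simp at hp)).ne
    have hq1 : 1 / q ≠ ∞ := (ENNReal.div_lt_top (by simp) (by rintro rfl; simp at hq)).ne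
    rw [← ENNReal.toReal_add hp1 hq1]
    exact (ENNReal.lt_ofReal_iff_toReal_lt (ENNReal.add_ne_top.2 ⟨hp1, hq1⟩)).1 hpq
  obtain ⟨Q, hQ1, hQ2, hQ3⟩ := exists_Q hq hpq'
  obtain ⟨s, r, Qs, ρ, hrd, hs1, hr, hQs, hsr, hpos, hρ1, hρ2, hPρ, hPe, hconj⟩ :=
    params_exist (hdd2.trans hdd) hQ1 hip hQ2 hP1 hPi
  obtain ⟨P, hPdef⟩ : ∃ P, P = (pstar p).toReal := ⟨_, rfl⟩
  rw [← hPdef] at hP1 hPi hPρ hPe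
  have hP0 : 0 < P := by linarith
  have hθ : 1 < ρ / P := (one_lt_div hP0).2 hPρ
  obtain ⟨C, hC⟩ : ∃ C, C = 320 * s ^ 2 * CS1 ^ 2 + 4 * Creg := ⟨_, rfl⟩
  have hC1 : 1 ≤ C := by
    have : 0 ≤ 320 * s ^ 2 * CS1 ^ 2 := by positivity
    rw [hC]; linarith
  obtain ⟨S1, hS1⟩ : ∃ S1, S1 = ∑' j : ℕ, 1 / (2 * (ρ / P) ^ j) := ⟨_, rfl⟩
  obtain ⟨S2, hS2⟩ : ∃ S2, S2 = ∑' j : ℕ, (j : ℝ) * (1 / (2 * (ρ / P) ^ j)) := ⟨_, rfl⟩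
  have hS1pos : 0 < S1 := by
    rw [hS1]
    have hsum : Summable fun j : ℕ => 1 / (2 * (ρ / P) ^ j) := summable_geo hθ
    exact hsum.tsum_pos (fun j => by positivity) 0 (by norm_num)
  refine ⟨1 + S1, (4 * C) ^ S1 * (4 * (ρ / P) ^ 2) ^ S2, by linarith, by positivity, ?_⟩
  intro a has ha κ hκ h hh N4 N5 hG x0 hx0 n hn u hu hL phi hphi β hβ σ' σ h1 h2 h3
  obtain ⟨-, -, -, hVol, hSob⟩ := hG
  have hn4 : N4 x0 ≤ n := by have := le_max_left (N4 x0) (N5 x0); omega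
  have hn5 : N5 x0 ≤ n := by have := le_max_right (N4 x0) (N5 x0); omega
  have hfin := ball_finite a x0 (Nat.cast_nonneg (α := ℝ) n)
  obtain ⟨B, hB⟩ : ∃ B : Finset (Vert d), (B : Set (Vert d)) = ballCh a x0 (n : ℝ) :=
    ⟨hfin.toFinset, hfin.coe_toFinset⟩
  have hx0B : x0 ∈ B := by
    rw [← Finset.mem_coe, hB]; exact self_mem_ball a x0 (Nat.cast_nonneg n)
  have hBne : B.Nonempty := ⟨x0, hx0B⟩
  have hc : (0 : ℝ) < B.card := by exact_mod_cast Finset.card_pos.2 hBne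
  have hvol : (B.card : ℝ) ≤ Creg * (n : ℝ) ^ d := by
    have := (hVol x0 hx0 n hn4).2
    rw [← hB, Set.ncard_coe_finset] at this
    exact this
  have hn0 : 0 < n := by
    rcases Nat.eq_zero_or_pos n with hz | hz
    · subst hz
      rw [Nat.cast_zero, zero_pow (by omega), mul_zero] at hvol
      linarith
    · exact hz
  have hn0' : (0 : ℝ) < n := by exact_mod_cast hn0
  have hM : 1 ≤ mBound a p q phi x0 n := by
    unfold mBound
    rw [← hB]
    have e1 := one_le_avgNormR hp B hBne (fun x => max 1 (muA a x)) (fun x => le_max_left _ _)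
    have e2 := one_le_avgNormR hq B hBne (fun x => max 1 (nuA a x)) (fun x => le_max_left _ _)
    have e3 := avgNormR_nonneg p B (carre a phi fun z => (phi z)⁻¹)
    have e4 := one_le_mul_of_one_le_of_one_le e1 e2
    refine one_le_mul_of_one_le_of_one_le e4 ?_
    have : 0 ≤ avgNormR p (B : Set (Vert d)) (carre a phi fun z => (phi z)⁻¹) * (n : ℝ) ^ 2 := by
      positivity
    linarith
  obtain ⟨M, hMd⟩ : ∃ M, M = mBound a p q phi x0 n := ⟨_, rfl⟩
  rw [← hMd] at hM ⊢
  have hv : ∀ x, 0 ≤ phi x * u x := fun x => mul_nonneg (hphi x).le (hu x)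
  have hmono : ∀ σ' σ : ℝ, σ' ≤ σ → B.filter (· ∈ ballCh a x0 (σ' * n)) ⊆
      B.filter (· ∈ ballCh a x0 (σ * n)) := by
    intro t' t ht x hx
    rw [Finset.mem_filter] at hx ⊢
    exact ⟨hx.1, ball_mono a x0 (mul_le_mul_of_nonneg_right ht hn0'.le) hx.2⟩
  have hTnn : ∀ (A : Finset (Vert d)) (e e' : ℝ),
      0 ≤ ((B.card : ℝ)⁻¹ * ∑ x ∈ A, (phi x * u x) ^ e) ^ e' := by
    intro A e e'
    apply Real.rpow_nonneg
    apply mul_nonneg (by positivity)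
    exact Finset.sum_nonneg fun x _ => Real.rpow_nonneg (hv x) _
  have iter := moser_iter (fun σ => B.filter (· ∈ ballCh a x0 (σ * n))) hmono
    (fun x => phi x * u x) hv (N := B.card) (P := P) (ρ := ρ) (C := C) (M := M)
    hc hP1 hPρ hC1 hM
    (by
      intro t' t α g1 g2 g3 hα
      have hδ : 0 < t - t' := by linarith
      have hMδ : 0 ≤ α ^ 2 * (M / (t - t') ^ 2) := by positivity
      by_cases hgap : 2 ≤ (t - t') * n
      · have := concrete_step_large hp hq hQ3 hrd hs1 hr hQs hsr hpos hρ1 hρ2 hconj hCS1 a has ha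
          κ hκ h hh.1 x0 n hn0 B hB hBne (hSob x0 hx0 n hn5) u hu hL phi hphi t' t α
          g1 g2 g3 hα hgap
        rw [← hMd, ← hPdef] at this
        refine this.trans (mul_le_mul_of_nonneg_right ?_ (hTnn _ _ _))
        rw [mul_assoc _ (α ^ 2), mul_assoc C]
        refine mul_le_mul_of_nonneg_right ?_ hMδ
        rw [hC]; linarith
      · have := concrete_step_small hd hdd hP1 hPρ hPe hCreg B _ _ (hmono t' t g2.le) hBne n hvol
          (fun x => phi x * u x) hv hδ hα hM (not_le.1 hgap)
        refine this.trans (mul_le_mul_of_nonneg_right ?_ (hTnn _ _ _))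
        rw [mul_assoc _ (α ^ 2), mul_assoc C]
        refine mul_le_mul_of_nonneg_right ?_ hMδ
        have : 0 ≤ 320 * s ^ 2 * CS1 ^ 2 := by positivity
        rw [hC]; linarith)
    σ' σ h1 h2 h3
  rw [← hS1, ← hS2] at iter
  have hcoe : ∀ t : ℝ, t ≤ 1 → ((B.filter (· ∈ ballCh a x0 (t * n)) : Finset (Vert d)) :
      Set (Vert d)) = ballCh a x0 (t * n) := by
    intro t ht
    ext x
    rw [Finset.mem_coe, Finset.mem_filter]
    refine ⟨fun hx => hx.2, fun hx => ⟨?_, hx⟩⟩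
    rw [← Finset.mem_coe, hB]
    refine ball_mono a x0 ?_ hx
    calc t * n ≤ 1 * n := mul_le_mul_of_nonneg_right ht hn0'.le
      _ = n := one_mul _
  rw [← hcoe σ' (by linarith), ← hcoe σ h3]
  obtain ⟨A, hA⟩ : ∃ A, A = B.filter (· ∈ ballCh a x0 (σ * n)) := ⟨_, rfl⟩
  rw [← hA] at iter ⊢
  have h2ps : 2 * pstar p ≠ ∞ := ENNReal.mul_ne_top (by simp) hps
  have h2P : (2 * pstar p).toReal = 2 * P := by
    rw [ENNReal.toReal_mul, ← hPdef]; simp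
  have hAne : A.Nonempty := by
    refine ⟨x0, ?_⟩
    rw [hA, Finset.mem_filter]
    exact ⟨hx0B, self_mem_ball a x0 (mul_nonneg (by linarith) hn0'.le)⟩
  have hAc : (0 : ℝ) < A.card := by exact_mod_cast Finset.card_pos.2 hAne
  have hAB : (A.card : ℝ) ≤ B.card := by
    rw [hA]; exact_mod_cast Finset.card_filter_le _ _
  have hT : ((B.card : ℝ)⁻¹ * ∑ x ∈ A, (phi x * u x) ^ (2 * P)) ^ (1 / (2 * P)) ≤
      avgNormR (2 * pstar p) (A : Set (Vert d)) (fun z => phi z * u z) := by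
    rw [avgNormR_finset h2ps, h2P]
    have e1 : ∑ x ∈ A, |phi x * u x| ^ (2 * P) = ∑ x ∈ A, (phi x * u x) ^ (2 * P) :=
      Finset.sum_congr rfl fun x _ => by rw [abs_of_nonneg (hv x)]
    rw [e1]
    have e2 : 0 ≤ ∑ x ∈ A, (phi x * u x) ^ (2 * P) :=
      Finset.sum_nonneg fun x _ => Real.rpow_nonneg (hv x) _
    apply Real.rpow_le_rpow (mul_nonneg (by positivity) e2) _ (by positivity)
    exact mul_le_mul_of_nonneg_right (inv_anti₀ hAc hAB) e2
  have hδ : 0 < σ - σ' := by linarith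
  have hMδ : 1 ≤ M / (σ - σ') ^ 2 := by
    rw [le_div_iff₀ (by positivity), one_mul]
    have : (σ - σ') ^ 2 ≤ 1 := pow_le_one₀ hδ.le (by linarith)
    linarith
  have hβ1 : 1 < β := by
    have hone : (1 : ℝ≥0∞) < 2 * pstar p := by
      rw [← ENNReal.toReal_lt_toReal (by simp) h2ps, h2P, ENNReal.toReal_one]
      linarith
    exact lt_of_lt_of_le hone hβ
  have hR0 := avgNormR_nonneg (2 * pstar p) A (fun z => phi z * u z)
  have hK0 : 0 ≤ (4 * C) ^ S1 * (4 * (ρ / P) ^ 2) ^ S2 := by positivity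
  apply avgNormR_le_of_forall hβ1
  · exact mul_nonneg (mul_nonneg hK0 (Real.rpow_nonneg (by linarith) _)) hR0
  · intro x hx
    rw [abs_of_nonneg (hv x)]
    refine (iter x hx).trans ?_
    rw [Real.mul_rpow (by linarith) (by linarith)]
    have e3 : (M / (σ - σ') ^ 2) ^ S1 ≤ (M / (σ - σ') ^ 2) ^ (1 + S1) :=
      Real.rpow_le_rpow_of_exponent_le hMδ (by linarith)
    calc (4 * C) ^ S1 * (M / (σ - σ') ^ 2) ^ S1 * (4 * (ρ / P) ^ 2) ^ S2 *
          ((B.card : ℝ)⁻¹ * ∑ x ∈ A, (phi x * u x) ^ (2 * P)) ^ (1 / (2 * P))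
        = (4 * C) ^ S1 * (4 * (ρ / P) ^ 2) ^ S2 * (M / (σ - σ') ^ 2) ^ S1 *
          ((B.card : ℝ)⁻¹ * ∑ x ∈ A, (phi x * u x) ^ (2 * P)) ^ (1 / (2 * P)) := by ring
      _ ≤ _ := by
          apply mul_le_mul _ hT (hTnn _ _ _)
          · exact mul_nonneg hK0 (Real.rpow_nonneg (by linarith) _)
          · exact mul_le_mul_of_nonneg_left e3 hK0

end FPPPaper
end

section
/- Let φ := e^ψ with ψ(x) := −λ √h d_κ(0,x) for λ > 0, where d_κ is the FPP-type metric built from κ and a. Then for every δ > 0 there exists λ_0 = λ_0(δ,d) > 0 such that for all λ ∈ (0,λ_0): |Γ(φ,φ^{−1})| ≤ δ h κ on V. -/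
open MeasureTheory Filter ENNReal Topology
open scoped Classical

namespace FPPPaper

lemma sum_edgesOf_append {d : ℕ} (f : Vert d × Vert d → ℝ≥0∞) (x y : Vert d) :
    ∀ p : List (Vert d), p.getLast? = some x →
      ((edgesOf (p ++ [y])).map f).sum = ((edgesOf p).map f).sum + f (x, y)
  | [], h => by simp at h
  | [b], h => by
      simp at h
      subst h
      simp [edgesOf]
  | b :: c :: t, h => by
      have ih := sum_edgesOf_append f x y (c :: t) (by simpa using h)
      simp only [edgesOf, List.cons_append, List.tail_cons, List.zip_cons_cons, List.map_cons,
        List.sum_cons] at ih ⊢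
      rw [ih, add_assoc]

lemma sum_edgesOf_ne_top {d : ℕ} (a : Vert d → Vert d → ℝ) (κ : Vert d → ℝ) :
    ∀ p : List (Vert d), p.IsChain (openAdj a) →
      ((edgesOf p).map fun e => kapWeightE a κ e.1 e.2).sum ≠ ∞
  | [], _ => by simp [edgesOf]
  | [b], _ => by simp [edgesOf]
  | b :: c :: t, h => by
      rw [List.isChain_cons_cons] at h
      have ih := sum_edgesOf_ne_top a κ (c :: t) h.2
      simp only [edgesOf, List.tail_cons, List.zip_cons_cons, List.map_cons,
        List.sum_cons] at ih ⊢
      refine ENNReal.add_ne_top.2 ⟨?_, ih⟩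
      simp [kapWeightE, h.1.2]

lemma isOpenPath_append {d : ℕ} {a : Vert d → Vert d → ℝ} {z x y : Vert d}
    {p : List (Vert d)} (hp : IsOpenPath a z x p) (hxy : openAdj a x y) :
    IsOpenPath a z y (p ++ [y]) := by
  obtain ⟨h1, h2, h3⟩ := hp
  refine ⟨by simp [h1], by simp, ?_⟩
  refine List.IsChain.append h3 (by simp) ?_
  intro u hu v hv
  simp only [List.head?_cons, Option.mem_def, Option.some.injEq] at hv
  rw [Option.mem_def, h2, Option.some.injEq] at hu
  subst hu; subst hv
  exact hxy

lemma dkap_ne_top {d : ℕ} {a : Vert d → Vert d → ℝ} (κ : Vert d → ℝ) {x y : Vert d}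
    (h : openConn a x y) : dkap a κ x y ≠ ∞ := by
  obtain ⟨p, hp⟩ := h
  refine ne_top_of_le_ne_top (sum_edgesOf_ne_top a κ p hp.2.2) ?_
  exact iInf_le (fun p : {p : List (Vert d) // IsOpenPath a x y p} =>
    ((edgesOf p.1).map fun e => kapWeightE a κ e.1 e.2).sum) ⟨p, hp⟩

lemma dkap_step {d : ℕ} {a : Vert d → Vert d → ℝ} (κ : Vert d → ℝ) (z : Vert d)
    {x y : Vert d} (hxy : openAdj a x y) :
    dkap a κ z y ≤ dkap a κ z x + kapWeightE a κ x y := by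
  unfold dkap
  rw [ENNReal.iInf_add]
  refine le_iInf fun p => ?_
  refine (iInf_le _ ⟨p.1 ++ [y], isOpenPath_append p.2 hxy⟩).trans ?_
  rw [sum_edgesOf_append _ x y p.1 p.2.2.1]

lemma dkap_step_real {d : ℕ} {a : Vert d → Vert d → ℝ} (κ : Vert d → ℝ) (z : Vert d)
    {x y : Vert d} (hxy : openAdj a x y) (hx : openConn a z x) :
    (dkap a κ z y).toReal ≤ (dkap a κ z x).toReal +
      Real.sqrt (min 1 (min (κ x) (κ y) / a x y)) := by
  have h := dkap_step κ z hxy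
  have h1 := dkap_ne_top κ hx
  simp only [kapWeightE, hxy.2, if_true] at h
  have := ENNReal.toReal_mono (ENNReal.add_ne_top.2 ⟨h1, ENNReal.ofReal_ne_top⟩) h
  rwa [ENNReal.toReal_add h1 ENNReal.ofReal_ne_top,
    ENNReal.toReal_ofReal (Real.sqrt_nonneg _)] at this

lemma adj_of_mem_nbrs {d : ℕ} {x y : Vert d} (h : y ∈ nbrs x) : adj x y := by
  unfold nbrs at h
  rw [Finset.mem_image] at h
  obtain ⟨⟨i, b⟩, -, rfl⟩ := h
  unfold adj
  rw [Finset.sum_eq_single i]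
  · cases b <;> simp
  · intro j _ hj
    simp [Function.update_of_ne hj]
  · simp

lemma card_nbrs_le {d : ℕ} (x : Vert d) : ((nbrs x).card : ℝ) ≤ 2 * d := by
  have : (nbrs x).card ≤ d * 2 := by
    refine Finset.card_image_le.trans ?_
    simp
  have h2 : ((nbrs x).card : ℝ) ≤ ((d * 2 : ℕ) : ℝ) := by exact_mod_cast this
  push_cast at h2
  linarith

lemma exp_term_bound (u v : ℝ) (h : |v - u| ≤ 1) :
    |(Real.exp v - Real.exp u) * ((Real.exp v)⁻¹ - (Real.exp u)⁻¹)| ≤ 4 * (v - u) ^ 2 := by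
  have e : (Real.exp v - Real.exp u) * ((Real.exp v)⁻¹ - (Real.exp u)⁻¹)
      = (Real.exp (v - u) - 1) * (Real.exp (-(v - u)) - 1) := by
    rw [neg_sub, Real.exp_sub, Real.exp_sub]
    have := Real.exp_pos u
    have := Real.exp_pos v
    field_simp
  rw [e, abs_mul]
  have h1 := Real.abs_exp_sub_one_le h
  have h2 := Real.abs_exp_sub_one_le (x := -(v - u)) (by rwa [abs_neg])
  rw [abs_neg] at h2
  calc _ ≤ (2 * |v - u|) * (2 * |v - u|) := by gcongr
    _ = 4 * |v - u| ^ 2 := by ring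
    _ = _ := by rw [sq_abs]

/-- Lemma `lem:GammaPhi`: for `φ = e^ψ` with
`ψ(x) = -λ √h d_κ(0,x)`, for every `δ > 0` there is `λ₀ = λ₀(δ,d) > 0` such
that for all `λ ∈ (0,λ₀)`, `|Γ(φ,φ⁻¹)| ≤ δ h κ` on `V`. -/
theorem statement19
    {d : ℕ} (hd : 2 ≤ d) (δ : ℝ) (hδ : 0 < δ) :
    ∃ lam0 : ℝ, 0 < lam0 ∧
      ∀ (a : Vert d → Vert d → ℝ), (∀ x y, a x y = a y x) → (∀ x y, 0 ≤ a x y) →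
      ∀ κ : Vert d → ℝ, (∀ x, 0 < κ x) → ∀ h ∈ Set.Icc (0:ℝ) 1,
      (0 : Vert d) ∈ Cinf a →
      (∀ x ∈ Cinf a, ∀ y ∈ Cinf a, openConn a x y) →
      ∀ lam : ℝ, lam ∈ Set.Ioo 0 lam0 →
      ∀ x ∈ Cinf a,
        |carre a
            (fun z => Real.exp (-(lam * Real.sqrt h * (dkap a κ 0 z).toReal)))
            (fun z => (Real.exp (-(lam * Real.sqrt h * (dkap a κ 0 z).toReal)))⁻¹)
            x| ≤ δ * h * κ x := by
  have hd0 : (0:ℝ) < d := by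
    have : 0 < d := by omega
    exact_mod_cast this
  refine ⟨min 1 (δ / (8 * d)), lt_min one_pos (by positivity), ?_⟩
  intro a hsym hnn κ hκ h hh h0 hconn lam hlam x hx
  obtain ⟨hl0, hl1⟩ := hlam
  have hlam1 : lam ≤ 1 := (hl1.trans_le (min_le_left _ _)).le
  have hlam2 : lam * (8 * d) ≤ δ := by
    have := (hl1.trans_le (min_le_right _ _)).le
    rwa [le_div_iff₀ (by positivity)] at this
  have hsq : Real.sqrt h ≤ 1 := by
    rw [Real.sqrt_le_left (by norm_num), one_pow]
    exact hh.2
  have hsq2 : Real.sqrt h ^ 2 = h := Real.sq_sqrt hh.1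
  have hterm : ∀ y ∈ nbrs x,
      |a x y * (Real.exp (-(lam * Real.sqrt h * (dkap a κ 0 y).toReal)) -
          Real.exp (-(lam * Real.sqrt h * (dkap a κ 0 x).toReal))) *
        ((Real.exp (-(lam * Real.sqrt h * (dkap a κ 0 y).toReal)))⁻¹ -
          (Real.exp (-(lam * Real.sqrt h * (dkap a κ 0 x).toReal)))⁻¹)|
      ≤ 4 * lam ^ 2 * h * κ x := by
    intro y hy
    rcases (hnn x y).eq_or_lt with ha | ha
    · rw [← ha]
      have := hκ x
      have := hh.1
      simp only [zero_mul, abs_zero]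
      positivity
    have hxy : openAdj a x y := ⟨adj_of_mem_nbrs hy, ha⟩
    have hyx : openAdj a y x := ⟨adj_symm' hxy.1, by rw [hsym]; exact ha⟩
    have hcx : openConn a 0 x := hconn 0 h0 x hx
    have hcy : openConn a 0 y := by
      obtain ⟨p, hp⟩ := hcx
      exact ⟨_, isOpenPath_append hp hxy⟩
    have s1 := dkap_step_real κ 0 hxy hcx
    have s2 := dkap_step_real κ 0 hyx hcy
    rw [hsym y x, min_comm (κ y) (κ x)] at s2
    set D := (dkap a κ 0 x).toReal
    set D' := (dkap a κ 0 y).toReal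
    set m := min 1 (min (κ x) (κ y) / a x y) with hm
    have hm0 : 0 ≤ m := by
      have := hκ x
      have := hκ y
      positivity
    have hw : |D' - D| ≤ Real.sqrt m := by rw [abs_le]; constructor <;> linarith
    have hw1 : Real.sqrt m ≤ 1 := by
      rw [Real.sqrt_le_left (by norm_num), one_pow]
      exact min_le_left _ _
    have hmk : a x y * m ≤ κ x := by
      have : m ≤ κ x / a x y := (min_le_right _ _).trans (by gcongr; exact min_le_left _ _)
      rw [le_div_iff₀ ha] at this
      linarith
    have hdsq : (D' - D) ^ 2 ≤ m := by
      rw [← sq_abs, ← Real.sq_sqrt hm0]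
      gcongr
    have hdiff : -(lam * Real.sqrt h * D') - -(lam * Real.sqrt h * D)
        = -(lam * Real.sqrt h * (D' - D)) := by ring
    have hb := exp_term_bound (-(lam * Real.sqrt h * D)) (-(lam * Real.sqrt h * D')) (by
      rw [hdiff, abs_neg, abs_mul, abs_of_nonneg (by positivity)]
      have : lam * Real.sqrt h ≤ 1 := mul_le_one₀ hlam1 (Real.sqrt_nonneg _) hsq
      exact mul_le_one₀ this (abs_nonneg _) (hw.trans hw1))
    rw [hdiff] at hb
    rw [mul_assoc, abs_mul, abs_of_pos ha]
    calc _ ≤ a x y * (4 * (-(lam * Real.sqrt h * (D' - D))) ^ 2) := by gcongr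
      _ = 4 * lam ^ 2 * Real.sqrt h ^ 2 * (a x y * (D' - D) ^ 2) := by ring
      _ = 4 * lam ^ 2 * h * (a x y * (D' - D) ^ 2) := by rw [hsq2]
      _ ≤ 4 * lam ^ 2 * h * κ x := by
        have := hh.1
        have : a x y * (D' - D) ^ 2 ≤ κ x := le_trans (by gcongr) hmk
        gcongr
  unfold carre
  refine (Finset.abs_sum_le_sum_abs _ _).trans ?_
  refine (Finset.sum_le_card_nsmul _ _ _ hterm).trans ?_
  rw [nsmul_eq_mul]
  have hk := (hκ x).le
  have hh0 := hh.1
  calc _ ≤ (2 * d : ℝ) * (4 * lam ^ 2 * h * κ x) := by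
        gcongr
        exact card_nbrs_le x
    _ = (lam * (lam * (8 * d))) * (h * κ x) := by ring
    _ ≤ (1 * δ) * (h * κ x) := by gcongr
    _ = _ := by ring

end FPPPaper
end
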